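/- arXiv:1702.02115 — 3 statements merged into one kernel-verified Lean document; each statement's English description precedes it below -/
import Mathlib

section
/- Let P be a polynomial with complex coefficients of degree d ≥ 2 and let m ≥ 1 be such that P^m(0) = 0 and (P^m)'(0) is a root of unity (0 is a parabolic periodic point of P). Then for every ε > 0 there exists a polynomial P̃ of degree d, each of whose coefficients differs from the corresponding coefficient of P by less than ε, such that P̃^m(0) = 0, |(P̃^m)'(0)| > 1 (0 is a repelling periodic point of P̃), and 0 belongs to the postcritical set of P̃, i.e. 0 ∈ ∪_{n≥1} P̃^n({w ∈ ℂ : P̃'(w) = 0}). -/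
open Metric Set Filter Topology

namespace PB

/-- Bloch theorem with a non-optimal constant. -/
theorem bloch {f : ℂ → ℂ} {c : ℂ} {R : ℝ} (hR : 0 < R) (hf : DifferentiableOn ℂ f (ball c R)) :
    ∃ w, ball w (R * ‖deriv f c‖ / 96) ⊆ f '' ball c R := by
  by_cases h0 : deriv f c = 0
  · refine ⟨0, ?_⟩
    simp [h0]
  have h0' : 0 < ‖deriv f c‖ := norm_pos_iff.2 h0
  have hder : DifferentiableOn ℂ (deriv f) (ball c R) := hf.deriv isOpen_ball
  set ρ := R / 2 with hρ
  have hρ0 : 0 < ρ := by positivity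
  have hsub : closedBall c ρ ⊆ ball c R := closedBall_subset_ball (by linarith)
  obtain ⟨a, ha, hmax⟩ := (isCompact_closedBall c ρ).exists_isMaxOn
    (f := fun z => ‖deriv f z‖ * (ρ - dist z c)) ⟨c, by simp [hρ0.le]⟩
    (((hder.continuousOn.mono hsub).norm).mul (by fun_prop))
  have hac : dist a c ≤ ρ := ha
  have h1 : ρ * ‖deriv f c‖ ≤ ‖deriv f a‖ * (ρ - dist a c) := by
    have := hmax (show c ∈ closedBall c ρ by simp [hρ0.le])
    simp only [dist_self, sub_zero, mem_ofPred_eq] at this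
    linarith
  have hpos : 0 < ‖deriv f a‖ * (ρ - dist a c) := lt_of_lt_of_le (by positivity) h1
  have hfa : 0 < ‖deriv f a‖ := by
    rcases (norm_nonneg (deriv f a)).eq_or_lt with h | h
    · rw [← h] at hpos; simp at hpos
    · exact h
  have hτ : 0 < ρ - dist a c := by
    by_contra h
    have := mul_nonpos_of_nonneg_of_nonpos hfa.le (not_lt.1 h)
    linarith
  set τ := (ρ - dist a c) / 2 with hτd
  have hτ0 : 0 < τ := by positivity
  have hballs : ball a τ ⊆ closedBall c ρ := fun z hz => by
    have : dist z a < τ := hz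
    have := dist_triangle z a c
    simp only [mem_closedBall]; linarith
  have h2 : ∀ z ∈ ball a τ, ‖deriv f z‖ ≤ 2 * ‖deriv f a‖ := by
    intro z hz
    have h3 := hmax (hballs hz)
    simp only [mem_ofPred_eq] at h3
    have : dist z a < τ := hz
    have := dist_triangle z a c
    have h4 : τ ≤ ρ - dist z c := by linarith
    have h5 : ‖deriv f z‖ * τ ≤ ‖deriv f z‖ * (ρ - dist z c) := by gcongr
    have h6 : ‖deriv f z‖ * τ ≤ (2 * ‖deriv f a‖) * τ := by
      calc _ ≤ _ := h5
        _ ≤ _ := h3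
        _ = _ := by rw [hτd]; ring
    exact le_of_mul_le_mul_right h6 hτ0
  have h3 : ∀ z ∈ ball a τ, ‖deriv f z - deriv f a‖ ≤ 3 * ‖deriv f a‖ / τ * dist z a := by
    intro z hz
    have := Complex.dist_le_div_mul_dist_of_mapsTo_ball (R₁ := τ) (R₂ := 3 * ‖deriv f a‖)
      (hder.mono (hballs.trans hsub)) (fun w hw => by
        rw [mem_closedBall, dist_eq_norm]
        have := norm_sub_le (deriv f w) (deriv f a)
        have := h2 w hw
        linarith) hz
    rwa [dist_eq_norm] at this
  have h4 : ∀ z ∈ closedBall a (τ / 6), ‖f z - f a - deriv f a * (z - a)‖ ≤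
      ‖deriv f a‖ / 2 * ‖z - a‖ := by
    intro z hz
    have hs : closedBall a (τ / 6) ⊆ ball a τ := closedBall_subset_ball (by linarith)
    have := Convex.norm_image_sub_le_of_norm_hasDerivWithin_le
      (f := fun z => f z - deriv f a * z) (f' := fun z => deriv f z - deriv f a)
      (s := closedBall a (τ / 6)) (C := ‖deriv f a‖ / 2) (x := a) (y := z) ?_ ?_
      (convex_closedBall _ _) (mem_closedBall_self (by positivity)) hz
    · refine le_trans (le_of_eq ?_) this
      congr 1
      ring
    · intro w hw
      have hd : HasDerivAt f (deriv f w) w :=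
        (hf.differentiableAt (isOpen_ball.mem_nhds (hsub (hballs (hs hw))))).hasDerivAt
      have := (hd.sub ((hasDerivAt_id w).const_mul (deriv f a))).hasDerivWithinAt
        (s := closedBall a (τ / 6))
      simp only [mul_one, id] at this
      exact this
    · intro w hw
      refine (h3 w (hs hw)).trans ?_
      have : dist w a ≤ τ / 6 := hw
      calc 3 * ‖deriv f a‖ / τ * dist w a ≤ 3 * ‖deriv f a‖ / τ * (τ / 6) := by gcongr
        _ = _ := by field_simp; norm_num
  have hs : closedBall a (τ / 6) ⊆ ball c R :=
    (closedBall_subset_ball (by linarith)).trans (hballs.trans hsub)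
  have h5 : ∀ z ∈ closedBall a (τ / 6), ‖deriv f a‖ / 2 * ‖z - a‖ ≤ ‖f z - f a‖ := by
    intro z hz
    have := h4 z hz
    have h6 : ‖deriv f a * (z - a)‖ ≤ ‖f z - f a‖ + ‖f z - f a - deriv f a * (z - a)‖ := by
      have := norm_sub_le (f z - f a) (f z - f a - deriv f a * (z - a))
      simpa using this
    rw [norm_mul] at h6
    linarith
  have hdc : DiffContOnCl ℂ f (ball a (τ / 6)) := by
    apply DifferentiableOn.diffContOnCl
    rw [closure_ball _ (by positivity)]
    exact hf.mono hs
  have h6 := hdc.ball_subset_image_closedBall (ε := ‖deriv f a‖ / 2 * (τ / 6)) (by positivity)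
    (fun z hz => by
      have := h5 z (sphere_subset_closedBall hz)
      have h7 : ‖z - a‖ = τ / 6 := by simpa [dist_eq_norm] using hz
      rwa [h7] at this) (by
      have : ∀ᶠ z in 𝓝[≠] a, f z ≠ f a := by
        have hn : ∀ᶠ z in 𝓝[≠] a, z ∈ closedBall a (τ / 6) :=
          mem_nhdsWithin_of_mem_nhds (closedBall_mem_nhds _ (by positivity))
        filter_upwards [hn, self_mem_nhdsWithin] with z hz hza heq
        have h8 := h5 z hz
        rw [heq, sub_self, norm_zero] at h8
        have : 0 < ‖z - a‖ := norm_pos_iff.2 (sub_ne_zero.2 hza)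
        have : 0 < ‖deriv f a‖ / 2 * ‖z - a‖ := by positivity
        linarith
      exact this.frequently.filter_mono nhdsWithin_le_nhds)
  refine ⟨f a, (ball_subset_ball ?_).trans (h6.trans (image_mono hs))⟩
  have : R * ‖deriv f c‖ = 2 * (ρ * ‖deriv f c‖) := by rw [hρ]; ring
  have : ‖deriv f a‖ * (ρ - dist a c) = 2 * (‖deriv f a‖ * τ) := by rw [hτd]; ring
  linarith

theorem exists_log {f : ℂ → ℂ} {c : ℂ} {R : ℝ} (hR : 0 < R) (hf : DifferentiableOn ℂ f (ball c R))
    (h0 : ∀ z ∈ ball c R, f z ≠ 0) :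
    ∃ g : ℂ → ℂ, DifferentiableOn ℂ g (ball c R) ∧ ∀ z ∈ ball c R, f z = Complex.exp (g z) := by
  obtain ⟨L, hL⟩ := DifferentiableOn.isExactOn_ball ((hf.deriv isOpen_ball).div hf h0)
  have hcb : c ∈ ball c R := by simp [hR]
  have hd : ∀ z ∈ ball c R, HasDerivWithinAt (fun z => f z * Complex.exp (- L z)) 0 (ball c R) z := by
    intro z hz
    have h1 : HasDerivAt f (deriv f z) z :=
      (hf.differentiableAt (isOpen_ball.mem_nhds hz)).hasDerivAt
    have h2 := h1.mul (hL z hz).neg.cexp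
    have h3 : HasDerivAt (fun z => f z * Complex.exp (- L z)) 0 z := by
      refine h2.congr_deriv ?_
      have := h0 z hz
      change deriv f z * Complex.exp (-L z) + f z * (Complex.exp (-L z) * -(deriv f z / f z)) = 0
      field_simp
      ring
    exact h3.hasDerivWithinAt
  have hconst : ∀ z ∈ ball c R, f z * Complex.exp (- L z) = f c * Complex.exp (- L c) := by
    intro z hz
    have := Convex.norm_image_sub_le_of_norm_hasDerivWithin_le (C := 0) hd (by simp)
      (convex_ball _ _) hcb hz
    simpa [sub_eq_zero] using this
  refine ⟨fun z => L z + Complex.log (f c * Complex.exp (- L c)), ?_, ?_⟩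
  · intro z hz
    exact ((hL z hz).differentiableAt.add_const _).differentiableWithinAt
  · intro z hz
    rw [Complex.exp_add, Complex.exp_log, ← hconst z hz, mul_left_comm, ← Complex.exp_add]
    · simp
    · exact mul_ne_zero (h0 c hcb) (Complex.exp_ne_zero _)

theorem abs_im_le_norm_cos (z : ℂ) : |z.im| ≤ ‖Complex.cos z‖ := by
  have h := Complex.cos_eq z
  have hre : (Complex.cos z).re = Real.cos z.re * Real.cosh z.im := by
    rw [h]; simp [← Complex.ofReal_cos, ← Complex.ofReal_cosh, ← Complex.ofReal_sin, ← Complex.ofReal_sinh]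
  have him : (Complex.cos z).im = - (Real.sin z.re * Real.sinh z.im) := by
    rw [h]; simp [← Complex.ofReal_cos, ← Complex.ofReal_cosh, ← Complex.ofReal_sin, ← Complex.ofReal_sinh]
  have h1 : ‖Complex.cos z‖ ^ 2 = Real.cos z.re ^ 2 + Real.sinh z.im ^ 2 := by
    rw [Complex.sq_norm, Complex.normSq_apply, hre, him]
    have := Real.cosh_sq z.im
    have := Real.sin_sq_add_cos_sq z.re
    have h3 : Real.sin z.re ^ 2 = 1 - Real.cos z.re ^ 2 := by linarith
    calc _ = Real.cos z.re ^ 2 * Real.cosh z.im ^ 2 + Real.sin z.re ^ 2 * Real.sinh z.im ^ 2 := by ring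
      _ = _ := by rw [h3, Real.cosh_sq]; ring
  have h2 : |z.im| ≤ |Real.sinh z.im| := by
    rcases le_total 0 z.im with h | h
    · rw [abs_of_nonneg h, abs_of_nonneg (Real.sinh_nonneg_iff.2 h)]
      exact Real.self_le_sinh_iff.2 h
    · rw [abs_of_nonpos h, abs_of_nonpos (Real.sinh_nonpos_iff.2 h)]
      have := Real.sinh_le_self_iff.2 h
      linarith
  refine h2.trans (abs_le_of_sq_le_sq ?_ (norm_nonneg _))
  rw [h1]
  nlinarith [sq_nonneg (Real.cos z.re)]

theorem exists_cos {h : ℂ → ℂ} {c : ℂ} {R : ℝ} (hR : 0 < R) (hf : DifferentiableOn ℂ h (ball c R))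
    (h1 : ∀ z ∈ ball c R, h z ≠ 1) (h2 : ∀ z ∈ ball c R, h z ≠ -1) :
    ∃ g : ℂ → ℂ, DifferentiableOn ℂ g (ball c R) ∧
      (∀ z ∈ ball c R, h z = Complex.cos (Real.pi * g z)) ∧ ‖g c‖ ≤ 1 + ‖h c‖ := by
  have hcb : c ∈ ball c R := by simp [hR]
  have hpi : (Real.pi : ℂ) ≠ 0 := by exact_mod_cast Real.pi_ne_zero
  obtain ⟨L, hLd, hL⟩ := exists_log hR (f := fun z => 1 - h z ^ 2) ((hf.pow 2).const_sub 1)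
    (fun z hz h0 => by
      have : (1 - h z) * (1 + h z) = 0 := by linear_combination h0
      rcases mul_eq_zero.1 this with h3 | h3
      · exact h1 z hz (by linear_combination -h3)
      · exact h2 z hz (by linear_combination h3))
  set q : ℂ → ℂ := fun z => Complex.exp (L z / 2) with hq
  have hqd : DifferentiableOn ℂ q (ball c R) := (hLd.div_const 2).cexp
  have hq2 : ∀ z ∈ ball c R, q z ^ 2 = 1 - h z ^ 2 := by
    intro z hz
    rw [hL z hz, hq, ← Complex.exp_nat_mul]
    congr 1; push_cast; ring
  have hI := Complex.I_sq
  obtain ⟨L2, hL2d, hL2⟩ := exists_log hR (f := fun z => h z + Complex.I * q z)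
    (hf.add (hqd.const_mul _)) (fun z hz h0 => by
      have : (h z + Complex.I * q z) * (h z - Complex.I * q z) = 1 := by
        linear_combination hq2 z hz - q z ^ 2 * hI
      rw [h0] at this; simp at this)
  have hcos : ∀ z ∈ ball c R, h z = Complex.cos (L2 z / Complex.I) := by
    intro z hz
    have e1 : Complex.exp (L2 z / Complex.I * Complex.I) = h z + Complex.I * q z := by
      rw [div_mul_cancel₀ _ Complex.I_ne_zero, ← hL2 z hz]
    have e2 : Complex.exp (-(L2 z / Complex.I) * Complex.I) = h z - Complex.I * q z := by
      rw [neg_mul, Complex.exp_neg, e1]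
      have : (h z + Complex.I * q z) * (h z - Complex.I * q z) = 1 := by
        linear_combination hq2 z hz - q z ^ 2 * hI
      exact inv_eq_of_mul_eq_one_right this
    rw [Complex.cos, e1, e2]; ring
  set w : ℂ := L2 c / Complex.I / (2 * Real.pi) with hw
  set k : ℤ := - round w.re with hk
  refine ⟨fun z => L2 z / Complex.I / Real.pi + 2 * k, ?_, ?_, ?_⟩
  · exact ((hL2d.div_const _).div_const _).add_const _
  · intro z hz
    rw [hcos z hz, ← Complex.cos_add_int_mul_two_pi _ k]
    congr 1
    field_simp
  · have e : L2 c / Complex.I / Real.pi + 2 * k = 2 * (w + k) := by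
      rw [hw]; field_simp
    have e2 : h c = Complex.cos (2 * Real.pi * (w + k)) := by
      rw [hcos c hcb, ← Complex.cos_add_int_mul_two_pi _ k, hw]
      congr 1
      field_simp
    have h3 := abs_im_le_norm_cos (2 * Real.pi * (w + k))
    rw [← e2] at h3
    have h4 : ((2 : ℂ) * Real.pi * (w + k)).im = 2 * Real.pi * w.im := by
      have : ((2 : ℂ) * Real.pi * (w + k)) = ((2 * Real.pi : ℝ) : ℂ) * (w + ((k : ℝ) : ℂ)) := by
        push_cast; ring
      rw [this, Complex.re_ofReal_mul |> fun _ => Complex.im_ofReal_mul]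
      simp
    rw [h4, abs_mul, abs_of_pos (by positivity : 0 < 2 * Real.pi)] at h3
    have h5 : |(w + k).re| ≤ 1 / 2 := by
      have := abs_sub_round w.re
      simpa [hk, sub_eq_add_neg] using this
    have h6 : |(w + k).im| ≤ ‖h c‖ / 2 := by
      have h7 : (w + k).im = w.im := by simp
      rw [h7]
      have := Real.pi_gt_three
      nlinarith [abs_nonneg w.im]
    change ‖L2 c / Complex.I / Real.pi + 2 * k‖ ≤ _
    rw [e, norm_mul]
    have := Complex.norm_le_abs_re_add_abs_im (w + k)
    simp only [Complex.norm_ofNat]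
    linarith

theorem cos_int_pi (x : ℂ) (n : ℤ) :
    (Even n ∧ Complex.cos (x + n * Real.pi) = Complex.cos x) ∨
    (Odd n ∧ Complex.cos (x + n * Real.pi) = - Complex.cos x) := by
  rcases Int.even_or_odd' n with ⟨k, rfl | rfl⟩
  · left
    refine ⟨by simp, ?_⟩
    rw [← Complex.cos_add_int_mul_two_pi x k]
    congr 1; push_cast; ring
  · right
    refine ⟨by simp, ?_⟩
    rw [← Complex.cos_add_int_mul_two_pi x k, ← Complex.cos_add_pi]
    congr 1; push_cast; ring

theorem exists_cos_int (w : ℂ) : ∃ z : ℂ, dist z w < 3 ∧ ∃ n : ℤ, Complex.cos (Real.pi * z) = n := by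
  -- work with |Im w|
  set a := Real.pi * |w.im| with ha
  have ha0 : 0 ≤ a := by positivity
  set n : ℤ := ⌈Real.cosh a⌉ with hn
  have hc2 : (2 : ℝ) ≤ Real.cosh 2 := by
    have := Real.cosh_sq 2
    have h2 : (2 : ℝ) ≤ Real.sinh 2 := Real.self_le_sinh_iff.2 (by norm_num)
    nlinarith [Real.cosh_pos 2]
  have h1 : Real.cosh a ≤ n := Int.le_ceil _
  have h2 : (n : ℝ) ≤ Real.cosh (a + 2) := by
    have h3 := Int.ceil_lt_add_one (Real.cosh a)
    rw [← hn] at h3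
    rw [Real.cosh_add]
    have h4 := Real.one_le_cosh a
    have h5 : 0 ≤ Real.sinh a := Real.sinh_nonneg_iff.2 ha0
    have h6 : 0 ≤ Real.sinh 2 := Real.sinh_nonneg_iff.2 (by norm_num)
    nlinarith [mul_nonneg h5 h6]
  obtain ⟨v, ⟨hv1, hv2⟩, hv⟩ := intermediate_value_Icc (by linarith : a ≤ a + 2)
    Real.continuous_cosh.continuousOn ⟨h1, h2⟩
  have hpi := Real.pi_gt_three
  have hpi0 : (Real.pi : ℂ) ≠ 0 := by exact_mod_cast Real.pi_ne_zero
  obtain ⟨u, hu, huv⟩ : ∃ u : ℝ, |u - w.im| ≤ 2 / Real.pi ∧ Real.cosh (Real.pi * u) = n := by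
    have h7 : |v / Real.pi - (|w.im|)| ≤ 2 / Real.pi := by
      have : v / Real.pi - |w.im| = (v - a) / Real.pi := by rw [ha]; field_simp
      rw [this, abs_div, abs_of_pos Real.pi_pos, abs_of_nonneg (by linarith)]
      gcongr; linarith
    rcases le_total 0 w.im with h | h
    · refine ⟨v / Real.pi, by rwa [abs_of_nonneg h] at h7, ?_⟩
      rw [← hv]; congr 1; field_simp
    · refine ⟨-(v / Real.pi), ?_, ?_⟩
      · rw [abs_of_nonpos h] at h7
        rw [← abs_neg]; convert h7 using 2; ring
      · rw [← hv, ← Real.cosh_neg]; congr 1; field_simp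
  refine ⟨(round w.re : ℝ) + u * Complex.I, ?_, ?_⟩
  · rw [Complex.dist_eq]
    refine (Complex.norm_le_abs_re_add_abs_im _).trans_lt ?_
    have h8 := abs_sub_round w.re
    rw [abs_sub_comm] at h8
    have h9 : 2 / Real.pi ≤ 1 := by rw [div_le_one (by positivity)]; linarith
    simp only [Complex.sub_re, Complex.add_re, Complex.ofReal_re, Complex.mul_re, Complex.I_re,
      Complex.sub_im, Complex.add_im, Complex.ofReal_im, Complex.mul_im, Complex.I_im]
    simp only [mul_zero, sub_zero, add_zero, mul_one, zero_add]
    linarith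
  · have e : (Real.pi : ℂ) * ((round w.re : ℝ) + u * Complex.I) =
        ((Real.pi * u : ℝ) : ℂ) * Complex.I + (round w.re : ℤ) * Real.pi := by
      push_cast; ring
    rw [e]
    rcases cos_int_pi (((Real.pi * u : ℝ) : ℂ) * Complex.I) (round w.re) with ⟨-, h⟩ | ⟨-, h⟩
    · refine ⟨n, ?_⟩
      rw [h, Complex.cos_mul_I, ← Complex.ofReal_cosh, huv]
      simp
    · refine ⟨-n, ?_⟩
      rw [h, Complex.cos_mul_I, ← Complex.ofReal_cosh, huv]
      simp

theorem norm_cos_le (z : ℂ) : ‖Complex.cos z‖ ≤ Real.exp ‖z‖ := by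
  rw [Complex.cos, norm_div]
  have h1 : ‖Complex.exp (z * Complex.I)‖ ≤ Real.exp ‖z‖ := by
    have := Complex.norm_exp_le_exp_norm (z * Complex.I)
    simpa using this
  have h2 : ‖Complex.exp (-z * Complex.I)‖ ≤ Real.exp ‖z‖ := by
    have := Complex.norm_exp_le_exp_norm (-z * Complex.I)
    simpa using this
  have := norm_add_le (Complex.exp (z * Complex.I)) (Complex.exp (-z * Complex.I))
  simp only [Complex.norm_ofNat]
  linarith

/-- A weak Schottky theorem. -/
theorem schottky (M : ℝ) : ∃ C : ℝ, ∀ (f : ℂ → ℂ) (c : ℂ) (R : ℝ), 0 < R →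
    DifferentiableOn ℂ f (ball c R) → (∀ z ∈ ball c R, f z ≠ 0) → (∀ z ∈ ball c R, f z ≠ 1) →
    ‖f c‖ ≤ M → ∀ z ∈ ball c (R / 2), ‖f z‖ ≤ C := by
  refine ⟨(1 + Real.exp (Real.pi * Real.exp (Real.pi * ((3 + 2 * M) + 288)))) / 2, ?_⟩
  intro f c R hR hf h0 h1 hM z hz
  have hcb : c ∈ ball c R := by simp [hR]
  obtain ⟨g, hgd, hg, hgc⟩ := exists_cos hR (h := fun z => 2 * f z - 1)
    ((hf.const_mul 2).sub_const 1)
    (fun z hz h => h1 z hz (by linear_combination h / 2))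
    (fun z hz h => h0 z hz (by linear_combination h / 2))
  have hcint : ∀ z ∈ ball c R, ∀ n : ℤ, g z ≠ n := by
    intro z hz n hn
    have h2 := hg z hz
    rw [hn, mul_comm (Real.pi : ℂ)] at h2
    rcases cos_int_pi 0 n with ⟨-, h⟩ | ⟨-, h⟩
    · rw [zero_add, Complex.cos_zero] at h
      rw [h] at h2
      exact h1 z hz (by linear_combination h2 / 2)
    · rw [zero_add, Complex.cos_zero] at h
      rw [h] at h2
      exact h0 z hz (by linear_combination h2 / 2)
  obtain ⟨g2, hg2d, hg2, hg2c⟩ := exists_cos hR hgd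
    (fun z hz h => hcint z hz 1 (by simpa using h))
    (fun z hz h => hcint z hz (-1) (by simpa using h))
  have hgc2 : ‖g2 c‖ ≤ 3 + 2 * M := by
    have h3 : ‖2 * f c - 1‖ ≤ 2 * ‖f c‖ + 1 := by
      refine (norm_sub_le _ _).trans ?_
      simp
    linarith
  have hder : ∀ w ∈ ball c (R / 2), ‖deriv g2 w‖ ≤ 576 / R := by
    intro w hw
    have hsub : ball w (R / 2) ⊆ ball c R := by
      apply ball_subset_ball'
      have : dist w c < R / 2 := hw
      linarith
    obtain ⟨p, hp⟩ := bloch (half_pos hR) (hg2d.mono hsub)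
    by_contra hcon
    push Not at hcon
    obtain ⟨q, hq, n, hn⟩ := exists_cos_int p
    have h3 : (3 : ℝ) ≤ R / 2 * ‖deriv g2 w‖ / 96 := by
      rw [div_lt_iff₀ hR] at hcon
      linarith
    obtain ⟨u, hu, huq⟩ := hp (ball_subset_ball h3 hq)
    apply hcint u (hsub hu) n
    rw [hg2 u (hsub hu), huq, hn]
  have hzc : z ∈ ball c R := ball_subset_ball (by linarith) hz
  have h4 : ‖g2 z - g2 c‖ ≤ 576 / R * ‖z - c‖ := by
    apply Convex.norm_image_sub_le_of_norm_deriv_le (s := ball c (R / 2)) _ hder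
      (convex_ball _ _) (by simp [hR]) hz
    intro w hw
    exact hg2d.differentiableAt (isOpen_ball.mem_nhds (ball_subset_ball (by linarith) hw))
  have h5 : ‖g2 z‖ ≤ (3 + 2 * M) + 288 := by
    have h6 : ‖z - c‖ ≤ R / 2 := by rw [← dist_eq_norm]; exact (mem_ball.1 hz).le
    have h7 : 576 / R * ‖z - c‖ ≤ 288 := by
      calc _ ≤ 576 / R * (R / 2) := by gcongr
        _ = _ := by field_simp; norm_num
    have h8 : ‖g2 z‖ ≤ ‖g2 z - g2 c‖ + ‖g2 c‖ := by simpa using norm_add_le (g2 z - g2 c) (g2 c)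
    linarith
  have h6 : ‖g z‖ ≤ Real.exp (Real.pi * ((3 + 2 * M) + 288)) := by
    rw [hg2 z hzc]
    refine (norm_cos_le _).trans (Real.exp_le_exp.2 ?_)
    rw [norm_mul, Complex.norm_real, Real.norm_of_nonneg Real.pi_pos.le]
    gcongr
  have h7 : ‖2 * f z - 1‖ ≤ Real.exp (Real.pi * Real.exp (Real.pi * ((3 + 2 * M) + 288))) := by
    rw [show 2 * f z - 1 = _ from hg z hzc]
    refine (norm_cos_le _).trans (Real.exp_le_exp.2 ?_)
    rw [norm_mul, Complex.norm_real, Real.norm_of_nonneg Real.pi_pos.le]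
    gcongr
  have h8 : 2 * ‖f z‖ ≤ ‖2 * f z - 1‖ + 1 := by
    have := norm_add_le (2 * f z - 1) 1
    simpa using this
  linarith

end PB


namespace PB

/-- Propagation of convergence to zero on a ball. -/
theorem vitali_ball {h : ℕ → ℂ → ℂ} {c : ℂ} {ρ M ε : ℝ} (hε : 0 < ε) (hρ : 0 < ρ)
    (hd : ∀ n, DifferentiableOn ℂ (h n) (ball c ρ)) (hM : ∀ n, ∀ z ∈ ball c ρ, ‖h n z‖ ≤ M)
    (hlim : TendstoUniformlyOn h 0 atTop (ball c ε)) :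
    TendstoUniformlyOn h 0 atTop (ball c (ρ / 2)) := by
  have hM0 : 0 ≤ M := (norm_nonneg _).trans (hM 0 c (by simp [hρ]))
  -- coefficients
  set a : ℕ → ℕ → ℂ := fun n j => ((j.factorial : ℂ))⁻¹ * iteratedDeriv j (h n) c with ha
  have hco : ∀ (n : ℕ) (r C : ℝ), 0 < r → r < ρ → (∀ z ∈ sphere c r, ‖h n z‖ ≤ C) →
      ∀ j, ‖a n j‖ ≤ C / r ^ j := by
    intro n r C hr hrρ hC j
    have hdc : DiffContOnCl ℂ (h n) (ball c r) := by
      apply DifferentiableOn.diffContOnCl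
      rw [closure_ball _ hr.ne']
      exact (hd n).mono (closedBall_subset_ball hrρ)
    have := Complex.norm_iteratedDeriv_le_of_forall_mem_sphere_norm_le j hr hdc hC
    rw [ha]
    simp only [norm_mul, norm_inv, Complex.norm_natCast]
    have hf : (0 : ℝ) < j.factorial := by positivity
    rw [inv_mul_le_iff₀ hf]
    calc _ ≤ _ := this
      _ = _ := by ring
  have hsum : ∀ n, ∀ z ∈ ball c ρ, HasSum (fun j => a n j * (z - c) ^ j) (h n z) := by
    intro n z hz
    have := Complex.hasSum_taylorSeries_on_ball (hd n) hz
    have e : (fun j => a n j * (z - c) ^ j) =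
        fun j => (↑j.factorial : ℂ)⁻¹ • (z - c) ^ j • iteratedDeriv j (h n) c := by
      funext j
      simp only [ha, smul_eq_mul]; ring
    rw [e]
    exact this
  have hbd : ∀ n j, ‖a n j‖ ≤ M / (3 * ρ / 4) ^ j := by
    intro n j
    refine hco n (3 * ρ / 4) M (by positivity) (by linarith) ?_ j
    intro z hz
    exact hM n z (closedBall_subset_ball (by linarith) (sphere_subset_closedBall hz))
  have ha0 : ∀ j, Tendsto (fun n => ‖a n j‖ * (ρ / 2) ^ j) atTop (𝓝 0) := by
    intro j
    set r := min (ε / 2) (ρ / 2) with hr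
    have hr0 : 0 < r := by positivity
    have h1 : Tendsto (fun n => a n j) atTop (𝓝 0) := by
      rw [Metric.tendsto_atTop]
      intro η hη
      rw [Metric.tendstoUniformlyOn_iff] at hlim
      obtain ⟨N, hN⟩ := eventually_atTop.1 (hlim (η * r ^ j / 2) (by positivity))
      refine ⟨N, fun n hn => ?_⟩
      have := hco n r (η * r ^ j / 2) hr0 (lt_of_le_of_lt (min_le_right _ _) (by linarith)) (by
        intro z hz
        have hz' : z ∈ ball c ε := closedBall_subset_ball
          (lt_of_le_of_lt (min_le_left _ _) (by linarith)) (sphere_subset_closedBall hz)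
        have := hN n hn z hz'
        simp only [Pi.zero_apply, dist_zero_left] at this
        exact this.le) j
      rw [dist_zero_right]
      refine this.trans_lt ?_
      rw [div_lt_iff₀ (by positivity)]
      have : 0 < η * r ^ j := by positivity
      linarith
    simpa using h1.norm.mul_const ((ρ / 2) ^ j)
  have hT : Tendsto (fun n => ∑' j, ‖a n j‖ * (ρ / 2) ^ j) atTop (𝓝 (∑' j : ℕ, (0 : ℝ))) := by
    refine tendsto_tsum_of_dominated_convergence (bound := fun j => M * (2 / 3 : ℝ) ^ j)
      ((summable_geometric_of_lt_one (by norm_num) (by norm_num)).mul_left M) ha0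
      (Eventually.of_forall fun n j => ?_)
    rw [norm_mul, norm_norm, norm_pow, Real.norm_of_nonneg (by positivity : 0 ≤ ρ / 2)]
    calc ‖a n j‖ * (ρ / 2) ^ j ≤ M / (3 * ρ / 4) ^ j * (ρ / 2) ^ j := by
          gcongr; exact hbd n j
      _ = M * (2 / 3) ^ j := by
        rw [div_mul_eq_mul_div, mul_div_assoc, ← div_pow]
        congr 2; field_simp; norm_num
  have hsm : ∀ n, Summable (fun j => ‖a n j‖ * (ρ / 2) ^ j) := by
    intro n
    refine Summable.of_nonneg_of_le (fun j => by positivity) (fun j => ?_)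
      ((summable_geometric_of_lt_one (r := 2 / 3) (by norm_num) (by norm_num)).mul_left M)
    calc ‖a n j‖ * (ρ / 2) ^ j ≤ M / (3 * ρ / 4) ^ j * (ρ / 2) ^ j := by
          gcongr; exact hbd n j
      _ = M * (2 / 3) ^ j := by
        rw [div_mul_eq_mul_div, mul_div_assoc, ← div_pow]
        congr 2; field_simp; norm_num
  rw [tsum_zero] at hT
  rw [Metric.tendstoUniformlyOn_iff]
  intro η hη
  filter_upwards [hT.eventually (gt_mem_nhds hη)] with n hn z hz
  simp only [Pi.zero_apply, dist_zero_left]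
  refine lt_of_le_of_lt ?_ hn
  have hz' : z ∈ ball c ρ := ball_subset_ball (by linarith) hz
  rw [← (hsum n z hz').tsum_eq]
  refine tsum_of_norm_bounded (hsm n).hasSum (fun j => ?_)
  rw [norm_mul, norm_pow]
  gcongr
  rw [← dist_eq_norm]; exact (mem_ball.1 hz).le

/-- A connectedness principle: a property holding on a ball around one point, which propagates
on balls of definite size, holds everywhere. -/
theorem clopen_principle {U : Set ℂ} (hUc : IsPreconnected U) (p : ℂ → Prop)
    (hopen : ∀ t ∈ U, ∃ r > 0, ∀ t' ∈ ball t r, p t' → ∀ t'' ∈ ball t r, p t'')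
    {t0 : ℂ} (ht0 : t0 ∈ U) (hp : p t0) : ∀ t ∈ U, p t := by
  by_contra! hcon
  obtain ⟨t1, ht1, hnp⟩ := hcon
  have := hUc {t | ∃ r > 0, ∀ t' ∈ ball t r, p t'} {t | ∃ r > 0, ∀ t' ∈ ball t r, ¬ p t'} ?_ ?_ ?_
    ⟨t0, ht0, ?_⟩ ⟨t1, ht1, ?_⟩
  · obtain ⟨t, -, ⟨r, hr, h⟩, ⟨r', hr', h'⟩⟩ := this
    exact h' t (by simp [hr']) (h t (by simp [hr]))
  · rw [Metric.isOpen_iff]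
    rintro t ⟨r, hr, h⟩
    refine ⟨r / 2, half_pos hr, fun t' ht' => ⟨r / 2, half_pos hr, fun t'' ht'' => h _ ?_⟩⟩
    have := dist_triangle t'' t' t
    have : dist t' t < r / 2 := ht'
    have : dist t'' t' < r / 2 := ht''
    simp only [mem_ball]; linarith
  · rw [Metric.isOpen_iff]
    rintro t ⟨r, hr, h⟩
    refine ⟨r / 2, half_pos hr, fun t' ht' => ⟨r / 2, half_pos hr, fun t'' ht'' => h _ ?_⟩⟩
    have := dist_triangle t'' t' t
    have : dist t' t < r / 2 := ht'
    have : dist t'' t' < r / 2 := ht''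
    simp only [mem_ball]; linarith
  · intro t ht
    obtain ⟨r, hr, h⟩ := hopen t ht
    by_cases hpt : p t
    · left
      exact ⟨r, hr, h t (by simp [hr]) hpt⟩
    · right
      exact ⟨r, hr, fun t' ht' hp' => hpt (h t' ht' hp' t (by simp [hr]))⟩
  · obtain ⟨r, hr, h⟩ := hopen t0 ht0
    exact ⟨r, hr, h t0 (by simp [hr]) hp⟩
  · obtain ⟨r, hr, h⟩ := hopen t1 ht1
    exact ⟨r, hr, fun t' ht' hp' => hnp (h t' ht' hp' t1 (by simp [hr]))⟩

/-- A weak form of the Vitali theorem. -/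
theorem vitali {U : Set ℂ} (hU : IsOpen U) (hUc : IsPreconnected U) {h : ℕ → ℂ → ℂ}
    (hd : ∀ n, DifferentiableOn ℂ (h n) U)
    (hb : ∀ t ∈ U, ∃ r > 0, ∃ M, ∀ n, ∀ z ∈ ball t r, ‖h n z‖ ≤ M)
    {t0 : ℂ} (ht0 : t0 ∈ U) {ε : ℝ} (hε : 0 < ε)
    (hlim : TendstoUniformlyOn h 0 atTop (ball t0 ε)) :
    ∀ t ∈ U, Tendsto (fun n => h n t) atTop (𝓝 0) := by
  have key := clopen_principle hUc (fun t => ∃ ε > 0, TendstoUniformlyOn h 0 atTop (ball t ε))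
    ?_ ht0 ⟨ε, hε, hlim⟩
  · intro t ht
    obtain ⟨ε, hε, h1⟩ := key t ht
    exact h1.tendsto_at (by simp [hε] : t ∈ ball t ε)
  · intro t ht
    obtain ⟨r, hr, M, hM⟩ := hb t ht
    obtain ⟨r', hr', hsub⟩ := Metric.isOpen_iff.1 hU t ht
    set R := min r r' with hR
    have hR0 : 0 < R := lt_min hr hr'
    refine ⟨R / 8, by positivity, ?_⟩
    rintro t' ht' ⟨ε, hε, h1⟩ t'' ht''
    have ht1 : dist t' t < R / 8 := ht'
    have ht2 : dist t'' t < R / 8 := ht''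
    have hs : ball t' (3 * R / 4) ⊆ ball t R := ball_subset_ball' (by linarith)
    have h2 := vitali_ball (ρ := 3 * R / 4) (M := M) hε (by positivity)
      (fun n => (hd n).mono (hs.trans ((ball_subset_ball (min_le_right _ _)).trans hsub)))
      (fun n z hz => hM n z (ball_subset_ball (min_le_left _ _) (hs hz))) h1
    refine ⟨R / 8, by positivity, h2.mono (ball_subset_ball' ?_)⟩
    have := dist_triangle_right t'' t' t
    linarith

end PB


namespace PB

theorem ift {G : ℂ × ℂ → ℂ} {s0 x0 D : ℂ} (hG : AnalyticAt ℂ G (s0, x0)) (h0 : G (s0, x0) = 0)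
    (hD : HasDerivAt (fun x => G (s0, x)) D x0) (hD0 : D ≠ 0) :
    ∃ x : ℂ → ℂ, AnalyticAt ℂ x s0 ∧ x s0 = x0 ∧ ∀ᶠ s in 𝓝 s0, G (s, x s) = 0 := by
  have hc : ContDiffAt ℂ ⊤ G (s0, x0) := hG.contDiffAt
  have e : (fderiv ℂ G (s0, x0) ∘L .inr ℂ ℂ ℂ) =
      (ContinuousLinearEquiv.unitsEquivAut ℂ (Units.mk0 D hD0) : ℂ →L[ℂ] ℂ) := by
    ext
    have h1 : HasFDerivAt (fun x => G (s0, x)) (fderiv ℂ G (s0, x0) ∘L .inr ℂ ℂ ℂ) x0 :=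
      HasFDerivAt.comp x0 (f := fun x => (s0, x)) (g := G)
        hG.differentiableAt.hasFDerivAt (hasFDerivAt_prodMk_right s0 x0)
    have h2 := h1.hasDerivAt.unique hD
    simpa using h2
  have hinv : (fderiv ℂ G (s0, x0) ∘L .inr ℂ ℂ ℂ).IsInvertible := ⟨_, e.symm⟩
  refine ⟨hc.implicitFunction (by simp) hinv, ?_, ?_, ?_⟩
  · exact (hc.contDiffAt_implicitFunction (by simp) hinv).analyticAt
  · exact hc.implicitFunction_apply_self (by simp) hinv
  · have := hc.eventually_apply_implicitFunction (by simp) hinv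
    rw [h0] at this
    exact this

/-- iterates of `P + s` -/
noncomputable def F (P : Polynomial ℂ) (s : ℂ) (n : ℕ) : ℂ → ℂ := (fun z => P.eval z + s)^[n]

/-- multipliers -/
noncomputable def D (P : Polynomial ℂ) (s : ℂ) (n : ℕ) (z : ℂ) : ℂ :=
  ∏ i ∈ Finset.range n, P.derivative.eval (F P s i z)

variable {P : Polynomial ℂ} {s z : ℂ}

theorem F_zero : F P s 0 z = z := rfl

theorem F_one : F P s 1 z = P.eval z + s := rfl

theorem F_succ (n : ℕ) : F P s (n + 1) z = P.eval (F P s n z) + s := by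
  rw [F, Function.iterate_succ_apply']; rfl

theorem F_add (a b : ℕ) : F P s (a + b) z = F P s a (F P s b z) := by
  rw [F, Function.iterate_add_apply]; rfl

theorem F_mul_fix {k : ℕ} (h : F P s k z = z) (n : ℕ) : F P s (k * n) z = z := by
  induction n with
  | zero => rfl
  | succ n ih => rw [Nat.mul_succ, F_add, h, ih]

theorem D_succ (n : ℕ) : D P s (n + 1) z = D P s n z * P.derivative.eval (F P s n z) := by
  rw [D, Finset.prod_range_succ]; rfl

theorem D_add (a b : ℕ) : D P s (a + b) z = D P s a (F P s b z) * D P s b z := by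
  rw [D, add_comm, Finset.prod_range_add, mul_comm]
  congr 1
  refine Finset.prod_congr rfl fun i _ => ?_
  rw [add_comm, F_add]

theorem D_mul_fix {k : ℕ} (h : F P s k z = z) (n : ℕ) : D P s (k * n) z = D P s k z ^ n := by
  induction n with
  | zero => simp [D]
  | succ n ih => rw [Nat.mul_succ, D_add, h, ih, pow_succ]

theorem hasDerivAt_F (n : ℕ) (z : ℂ) : HasDerivAt (F P s n) (D P s n z) z := by
  induction n with
  | zero => simpa [D, F] using hasDerivAt_id z
  | succ n ih =>
    have h := ((P.hasDerivAt (F P s n z)).comp z ih).add_const s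
    rw [D_succ]
    have e : F P s (n + 1) = fun z => (P.eval ∘ F P s n) z + s := by
      funext w; rw [F_succ]; rfl
    rw [e, mul_comm]
    exact h

theorem contDiff_eval (P : Polynomial ℂ) : ContDiff ℂ ⊤ (fun z : ℂ => P.eval z) := by
  have := P.contDiff_aeval (𝕜 := ℂ) ⊤
  simpa using this

theorem contDiff_F (P : Polynomial ℂ) (n : ℕ) : ContDiff ℂ ⊤ (fun p : ℂ × ℂ => F P p.1 n p.2) := by
  induction n with
  | zero => simpa [F] using contDiff_snd
  | succ n ih =>
    simp only [F_succ]
    exact ((contDiff_eval P).comp ih).add contDiff_fst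

theorem contDiff_D (P : Polynomial ℂ) (n : ℕ) : ContDiff ℂ ⊤ (fun p : ℂ × ℂ => D P p.1 n p.2) := by
  induction n with
  | zero => simpa [D] using contDiff_const
  | succ n ih =>
    simp only [D_succ]
    exact ih.mul ((contDiff_eval P.derivative).comp (contDiff_F P n))

theorem analyticAt_F (P : Polynomial ℂ) (n : ℕ) (p : ℂ × ℂ) :
    AnalyticAt ℂ (fun p : ℂ × ℂ => F P p.1 n p.2) p := (contDiff_F P n).contDiffAt.analyticAt

theorem analyticAt_D (P : Polynomial ℂ) (n : ℕ) (p : ℂ × ℂ) :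
    AnalyticAt ℂ (fun p : ℂ × ℂ => D P p.1 n p.2) p := (contDiff_D P n).contDiffAt.analyticAt

theorem continuous_F (P : Polynomial ℂ) (n : ℕ) : Continuous (fun p : ℂ × ℂ => F P p.1 n p.2) :=
  (contDiff_F P n).continuous

theorem continuous_D (P : Polynomial ℂ) (n : ℕ) : Continuous (fun p : ℂ × ℂ => D P p.1 n p.2) :=
  (contDiff_D P n).continuous

/-- iterates as polynomials -/
noncomputable def pF (P : Polynomial ℂ) (s : ℂ) (n : ℕ) : Polynomial ℂ :=
  (P + Polynomial.C s).comp^[n] Polynomial.X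

theorem pF_eval (n : ℕ) : (pF P s n).eval z = F P s n z := by
  rw [pF, Polynomial.iterate_comp_eval]
  simp [F]

theorem pF_derivative_eval (n : ℕ) : (pF P s n).derivative.eval z = D P s n z := by
  have h1 := (pF P s n).hasDerivAt z
  have e : (fun x => (pF P s n).eval x) = F P s n := by funext x; exact pF_eval n
  rw [e] at h1
  exact h1.unique (hasDerivAt_F n z)

theorem pF_natDegree (n : ℕ) : (pF P s n).natDegree = P.natDegree ^ n := by
  rw [pF, Polynomial.natDegree_iterate_comp]
  simp

theorem eq_crit_of_D {n : ℕ} (h : D P s n z = 0) :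
    ∃ i < n, P.derivative.eval (F P s i z) = 0 := by
  rw [D, Finset.prod_eq_zero_iff] at h
  obtain ⟨i, hi, h⟩ := h
  exact ⟨i, Finset.mem_range.1 hi, h⟩

/-- uniform contraction near an attracting fixed point -/
theorem contraction {s0 σ : ℂ} {k : ℕ} (h : F P s0 k σ = σ) (hD : ‖D P s0 k σ‖ < 1) {r0 : ℝ}
    (hr0 : 0 < r0) :
    ∃ q < 1, 0 ≤ q ∧ ∃ r > 0, r ≤ r0 ∧ ∀ᶠ s in 𝓝 s0,
      (∀ z ∈ closedBall σ r, F P s k z ∈ closedBall σ r) ∧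
      ∀ z ∈ closedBall σ r, ∀ w ∈ closedBall σ r, ‖F P s k z - F P s k w‖ ≤ q * ‖z - w‖ := by
  obtain ⟨q, hq1, hq2⟩ := exists_between hD
  have hq0 : 0 ≤ q := (norm_nonneg _).trans hq1.le
  have h1 : ∀ᶠ p : ℂ × ℂ in 𝓝 (s0, σ), ‖D P p.1 k p.2‖ < q :=
    (continuous_D P k).norm.continuousAt.eventually_lt_const hq1
  obtain ⟨r1, hr1, h1⟩ := Metric.eventually_nhds_iff_ball.1 h1
  set r := min (r1 / 2) r0 with hr
  have hr' : 0 < r := by positivity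
  have h2 : ∀ᶠ s in 𝓝 s0, ‖F P s k σ - σ‖ < (1 - q) * r := by
    have hc : ContinuousAt (fun s => ‖F P s k σ - σ‖) s0 := by
      have : Continuous (fun s => F P s k σ) :=
        (continuous_F P k).comp (by fun_prop : Continuous fun s : ℂ => (s, σ))
      fun_prop
    apply hc.eventually_lt_const
    simp only [h, sub_self, norm_zero]
    have : 0 < 1 - q := by linarith
    positivity
  refine ⟨q, hq2, hq0, r, hr', min_le_right _ _, ?_⟩
  filter_upwards [h2, ball_mem_nhds s0 hr1] with s hs2 hs1
  have hl : ∀ z ∈ closedBall σ r, ∀ w ∈ closedBall σ r,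
      ‖F P s k z - F P s k w‖ ≤ q * ‖z - w‖ := by
    intro z hz w hw
    refine Convex.norm_image_sub_le_of_norm_hasDerivWithin_le (s := closedBall σ r)
      (fun x _ => (hasDerivAt_F k x).hasDerivWithinAt) (fun x hx => ?_) (convex_closedBall _ _) hw hz
    refine (h1 (s, x) ?_).le
    rw [mem_ball, Prod.dist_eq, max_lt_iff]
    refine ⟨hs1, ?_⟩
    have : dist x σ ≤ r := hx
    have : r ≤ r1 / 2 := min_le_left _ _
    simp only; linarith
  refine ⟨fun z hz => ?_, hl⟩
  have h3 := hl z hz σ (mem_closedBall_self hr'.le)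
  have h4 : ‖z - σ‖ ≤ r := by rw [← dist_eq_norm]; exact hz
  rw [mem_closedBall, dist_eq_norm]
  have h5 : ‖F P s k z - σ‖ ≤ ‖F P s k z - F P s k σ‖ + ‖F P s k σ - σ‖ := norm_sub_le_norm_sub_add_norm_sub _ _ _
  have : q * ‖z - σ‖ ≤ q * r := by gcongr
  nlinarith

theorem poly_large {P : Polynomial ℂ} (h : 1 ≤ P.natDegree) (A : ℝ) :
    ∃ T > 0, ∀ z : ℂ, T ≤ ‖z‖ → A ≤ ‖P.eval z‖ := by
  have := Polynomial.tendsto_norm_atTop P (by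
    rw [← Polynomial.natDegree_pos_iff_degree_pos]; omega)
    (tendsto_norm_cocompact_atTop (E := ℂ))
  have h2 := this.eventually_ge_atTop A
  rw [← Metric.cobounded_eq_cocompact, ← comap_norm_atTop, eventually_comap] at h2
  obtain ⟨T, hT⟩ := eventually_atTop.1 h2
  exact ⟨max T 1, by positivity, fun z hz => hT _ ((le_max_left _ _).trans hz) z rfl⟩

theorem poly_superlinear {P : Polynomial ℂ} (h : 2 ≤ P.natDegree) (A : ℝ) :
    ∃ T > 0, ∀ z : ℂ, T ≤ ‖z‖ → A * ‖z‖ ≤ ‖P.eval z‖ := by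
  have hdeg : P.divX.natDegree = P.natDegree - 1 := Polynomial.natDegree_divX_eq_natDegree_tsub_one
  obtain ⟨T, hT0, hT⟩ := poly_large (P := P.divX) (by omega) (|A| + ‖P.coeff 0‖)
  refine ⟨max T 1, by positivity, fun z hz => ?_⟩
  have h1 : (1 : ℝ) ≤ ‖z‖ := (le_max_right _ _).trans hz
  have h2 := hT z ((le_max_left _ _).trans hz)
  have h3 : P.eval z = P.divX.eval z * z + P.coeff 0 := by
    conv_lhs => rw [← Polynomial.divX_mul_X_add P]
    simp
  have h4 : ‖P.divX.eval z‖ * ‖z‖ ≤ ‖P.eval z‖ + ‖P.coeff 0‖ := by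
    rw [← norm_mul]
    have : P.divX.eval z * z = P.eval z - P.coeff 0 := by rw [h3]; ring
    rw [this]; exact norm_sub_le _ _
  have h5 : (|A| + ‖P.coeff 0‖) * ‖z‖ ≤ ‖P.divX.eval z‖ * ‖z‖ := by gcongr
  have h6 := le_abs_self A
  have h7 : A * ‖z‖ ≤ |A| * ‖z‖ := by gcongr
  nlinarith [norm_nonneg (P.coeff 0)]

/-- For large `s` all periodic points are repelling. -/
theorem large_s (hP : 2 ≤ P.natDegree) :
    ∃ S : ℝ, ∀ s : ℂ, S < ‖s‖ → ∀ N ≥ 1, ∀ x, F P s N x = x → 1 < ‖D P s N x‖ := by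
  obtain ⟨T1, hT1, h1⟩ := poly_large (P := P.derivative) (by
    rw [Polynomial.natDegree_derivative]; omega) 2
  obtain ⟨T2, hT2, h2⟩ := poly_superlinear hP 3
  obtain ⟨M, hM⟩ := (isCompact_closedBall (0 : ℂ) T1).exists_bound_of_continuousOn
    (f := fun z => P.eval z) P.continuous.continuousOn
  have hM0 : 0 ≤ M := (norm_nonneg _).trans (hM 0 (by simp [hT1.le]))
  refine ⟨2 * M + T2 + 1, fun s hs N hN x hx => ?_⟩
  -- the escaping region
  have hesc : ∀ y : ℂ, ‖s‖ - M ≤ ‖y‖ → ∀ n, ‖y‖ + n ≤ ‖F P s n y‖ := by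
    intro y hy n
    induction n with
    | zero => simp [F_zero]
    | succ n ih =>
      rw [F_succ]
      set w := F P s n y
      have hn : (0 : ℝ) ≤ n := by positivity
      have h3 := h2 w (by linarith)
      have h4 : ‖P.eval w‖ ≤ ‖P.eval w + s‖ + ‖s‖ := by
        have := norm_sub_le (P.eval w + s) s
        simpa using this
      push_cast
      linarith
  have hbig : ∀ i, T1 < ‖F P s i x‖ := by
    intro i
    by_contra hcon
    push Not at hcon
    set y := F P s i x with hy
    have hyfix : F P s N y = y := by
      rw [hy, ← F_add, add_comm, F_add, hx]
    have h3 := hM y (by simpa using hcon)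
    have h4 : ‖s‖ - M ≤ ‖F P s 1 y‖ := by
      rw [F_one]
      have := norm_sub_le (P.eval y + s) (P.eval y)
      simp only [add_sub_cancel_left] at this
      linarith
    have h5 := hesc _ h4 N
    rw [← F_add N 1, add_comm N 1, F_add 1 N, hyfix] at h5
    have : (1 : ℝ) ≤ N := by exact_mod_cast hN
    linarith
  have h3 : ∀ n, (2 : ℝ) ^ n ≤ ‖D P s n x‖ := by
    intro n
    induction n with
    | zero => simp [D]
    | succ n ih =>
      rw [D_succ, norm_mul, pow_succ]
      exact mul_le_mul ih (h1 _ (hbig n).le) (by norm_num) (norm_nonneg _)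
  calc (1 : ℝ) < 2 ^ N := one_lt_pow₀ (by norm_num) (by omega)
    _ ≤ _ := h3 N

end PB


namespace PB

variable {P : Polynomial ℂ}

open Polynomial in
theorem pF_sub_natDegree (hP : 2 ≤ P.natDegree) (s : ℂ) {N : ℕ} (hN : 1 ≤ N) :
    (pF P s N - X).natDegree = P.natDegree ^ N := by
  have h1 : 1 < P.natDegree ^ N := Nat.one_lt_pow (by omega) (by omega)
  rw [natDegree_sub_eq_left_of_natDegree_lt, pF_natDegree]
  rw [pF_natDegree, natDegree_X]; exact h1

open Polynomial in
theorem finite_mult (hP : 2 ≤ P.natDegree) {N : ℕ} (hN : 1 ≤ N) {ω : ℂ} (hω : ‖ω‖ ≤ 1) :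
    {s : ℂ | ∃ x, F P s N x = x ∧ D P s N x = ω}.Finite := by
  let I : Polynomial (Polynomial ℂ) := ((P.map C) + C X).comp^[N] X
  have hI : ∀ s : ℂ, I.map (evalRingHom s) = pF P s N := by
    intro s
    have : ∀ n, ((((P.map C) + C X).comp^[n] X : Polynomial (Polynomial ℂ))).map (evalRingHom s)
        = (P + C s).comp^[n] X := by
      intro n
      induction n with
      | zero => simp
      | succ n ih =>
        rw [Function.iterate_succ_apply', Function.iterate_succ_apply', Polynomial.map_comp, ih]
        congr 1
        rw [Polynomial.map_add, Polynomial.map_map, Polynomial.map_C]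
        congr 1
        · have : (evalRingHom s).comp C = RingHom.id ℂ := by ext <;> simp
          rw [this, Polynomial.map_id]
        · simp
    exact this N
  set n := P.natDegree ^ N with hn
  let res : Polynomial ℂ := resultant (I - X) (derivative I - C (C ω)) n n
  have hres : ∀ s, res.eval s = (pF P s N - X).leadingCoeff ^ n *
      ((pF P s N - X).roots.map (fun z => (derivative (pF P s N) - C ω).eval z)).prod := by
    intro s
    have h1 : (evalRingHom s) res = resultant ((I - X).map (evalRingHom s))
      ((derivative I - C (C ω)).map (evalRingHom s)) n n := (resultant_map_map _ _ _ _ _).symm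
    have e1 : (I - X).map (evalRingHom s) = pF P s N - X := by
      rw [Polynomial.map_sub, hI, map_X]
    have e2 : (derivative I - C (C ω)).map (evalRingHom s) = derivative (pF P s N) - C ω := by
      rw [Polynomial.map_sub, ← derivative_map, hI]; simp
    rw [e1, e2] at h1
    have hd : (derivative (pF P s N) - C ω).natDegree ≤ n := by
      rw [natDegree_sub_C]
      exact (natDegree_derivative_le _).trans (by rw [pF_natDegree]; omega)
    have h2 := resultant_eq_prod_eval (pF P s N - X) (derivative (pF P s N) - C ω) n hd
      (IsAlgClosed.splits _)
    rw [pF_sub_natDegree hP s hN] at h2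
    exact h1.trans h2
  have hne : ∀ s, pF P s N - X ≠ 0 := by
    intro s h
    have := pF_sub_natDegree hP s hN
    rw [h, natDegree_zero] at this
    have : 0 < P.natDegree ^ N := by positivity
    omega
  have hres0 : res ≠ 0 := by
    intro h0
    obtain ⟨S, hS⟩ := large_s hP
    obtain ⟨s, hs⟩ : ∃ s : ℂ, S < ‖s‖ := ⟨((|S| + 1 : ℝ) : ℂ), by
      rw [Complex.norm_real, Real.norm_eq_abs, abs_of_pos (by positivity)]
      linarith [le_abs_self S]⟩
    have := hres s
    rw [h0, eval_zero] at this
    have h2 := (mul_eq_zero.1 this.symm).resolve_left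
      (pow_ne_zero _ (leadingCoeff_ne_zero.2 (hne s)))
    rw [Multiset.prod_eq_zero_iff, Multiset.mem_map] at h2
    obtain ⟨x, hx, hx2⟩ := h2
    rw [mem_roots (hne s), IsRoot, eval_sub, eval_X, pF_eval] at hx
    rw [eval_sub, eval_C, pF_derivative_eval] at hx2
    have := hS s hs N hN x (sub_eq_zero.1 hx)
    rw [sub_eq_zero.1 hx2] at this
    linarith
  refine (res.roots.toFinset.finite_toSet).subset ?_
  rintro s ⟨x, hx, hx2⟩
  simp only [Finset.mem_coe, Multiset.mem_toFinset]
  rw [mem_roots hres0, IsRoot, hres s]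
  refine mul_eq_zero_of_right _ (Multiset.prod_eq_zero_iff.2 (Multiset.mem_map.2 ⟨x, ?_, ?_⟩))
  · rw [mem_roots (hne s), IsRoot, eval_sub, eval_X, pF_eval, hx, sub_self]
  · rw [eval_sub, eval_C, pF_derivative_eval, hx2, sub_self]

end PB


namespace PB

variable {P : Polynomial ℂ}

theorem max_lemma {K : Set (ℂ × ℂ)} (hK : IsCompact K) {f : ℂ × ℂ → ℂ} (hf : ContinuousOn f K)
    {A M : ℝ} (hM0 : 0 ≤ M) (hA : ∀ p ∈ K, ‖p.1‖ ≤ A)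
    (hloc : ∀ p ∈ K, 0 < ‖p.1‖ → ‖p.1‖ < A → ∃ g : ℂ → ℂ, AnalyticAt ℂ g p.1 ∧ g p.1 = f p ∧
      ∀ᶠ s in 𝓝 p.1, ∃ x, (s, x) ∈ K ∧ f (s, x) = g s)
    (hM : ∀ p ∈ K, ‖p.1‖ = A → ‖f p‖ ≤ M) :
    ∀ p ∈ K, p.1 ≠ 0 → ‖f p‖ ≤ M := by
  intro p0 hp0 hs0
  by_contra hlt
  push Not at hlt
  have hs0' : 0 < ‖p0.1‖ := norm_pos_iff.2 hs0
  have hA0 : 0 < A := hs0'.trans_le (hA p0 hp0)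
  have hf0 : 0 < ‖f p0‖ := hM0.trans_lt hlt
  obtain ⟨n, hn⟩ : ∃ n : ℕ, (M / ‖f p0‖) ^ n < ‖p0.1‖ / A :=
    exists_pow_lt_of_lt_one (by positivity) ((div_lt_one hf0).2 hlt)
  rw [div_pow, div_lt_div_iff₀ (by positivity) hA0] at hn
  have hc : ContinuousOn (fun p : ℂ × ℂ => ‖f p‖ ^ n * ‖p.1‖) K :=
    (hf.norm.pow n).mul continuous_fst.norm.continuousOn
  obtain ⟨p1, hp1, hmax⟩ := hK.exists_isMaxOn ⟨p0, hp0⟩ hc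
  set V := ‖f p1‖ ^ n * ‖p1.1‖ with hV
  have hK' : IsCompact (K ∩ {p | ‖f p‖ ^ n * ‖p.1‖ = V}) := by
    have : K ∩ {p | ‖f p‖ ^ n * ‖p.1‖ = V} =
      K ∩ (fun p : ℂ × ℂ => ‖f p‖ ^ n * ‖p.1‖) ⁻¹' {V} := rfl
    rw [this]
    exact hK.of_isClosed_subset
      (hc.preimage_isClosed_of_isClosed hK.isClosed isClosed_singleton) inter_subset_left
  obtain ⟨q, ⟨hq, hqV⟩, hqmax⟩ := hK'.exists_isMaxOn ⟨p1, hp1, rfl⟩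
    (f := fun p : ℂ × ℂ => ‖p.1‖) continuous_fst.norm.continuousOn
  have hqV : ‖f q‖ ^ n * ‖q.1‖ = V := hqV
  have hVb : M ^ n * A < V := by
    have := hmax hp0
    simp only [mem_ofPred_eq] at this
    nlinarith
  have hV0 : 0 < V := lt_of_le_of_lt (by positivity) hVb
  have hq0 : 0 < ‖q.1‖ := by
    rcases (norm_nonneg q.1).eq_or_lt with h | h
    · rw [← h, mul_zero] at hqV; linarith
    · exact h
  rcases (hA q hq).eq_or_lt with h | h
  · have h1 := hM q hq h
    have h2 : ‖f q‖ ^ n ≤ M ^ n := pow_le_pow_left₀ (norm_nonneg _) h1 n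
    rw [h] at hqV
    nlinarith
  · obtain ⟨g, hg, hgq, hgK⟩ := hloc q hq hq0 h
    have hloc : IsLocalMax (norm ∘ fun s => g s ^ n * s) q.1 := by
      filter_upwards [hgK] with s ⟨x, hx, hfx⟩
      have := hmax hx
      simp only [mem_ofPred_eq] at this
      simp only [Function.comp, norm_mul, norm_pow, hgq, ← hfx]
      rw [hqV]; exact this
    have hd : ∀ᶠ s in 𝓝 q.1, DifferentiableAt ℂ (fun s => g s ^ n * s) s := by
      filter_upwards [hg.eventually_analyticAt] with s hs
      exact (hs.differentiableAt.pow n).mul differentiableAt_id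
    have hev := Complex.eventually_eq_of_isLocalMax_norm hd hloc
    have hev2 := hev.and hgK
    obtain ⟨ε, hε, hball⟩ := Metric.eventually_nhds_iff_ball.1 hev2
    set s : ℂ := q.1 + ((ε / 2 / ‖q.1‖ : ℝ) : ℂ) * q.1 with hs
    have hsb : s ∈ ball q.1 ε := by
      rw [mem_ball, dist_eq_norm, hs, add_sub_cancel_left, norm_mul, Complex.norm_real,
        Real.norm_of_nonneg (by positivity), div_mul_cancel₀ _ hq0.ne']
      linarith
    have hsn : ‖q.1‖ < ‖s‖ := by
      have : s = ((1 + ε / 2 / ‖q.1‖ : ℝ) : ℂ) * q.1 := by rw [hs]; push_cast; ring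
      rw [this, norm_mul, Complex.norm_real, Real.norm_of_nonneg (by positivity)]
      have : 0 < ε / 2 / ‖q.1‖ := by positivity
      nlinarith
    obtain ⟨h1, x, hx, hfx⟩ := hball s hsb
    have h2 := congrArg norm h1
    simp only [norm_mul, norm_pow, hgq, hqV, ← hfx] at h2
    have := hqmax (show (s, x) ∈ K ∩ {p | ‖f p‖ ^ n * ‖p.1‖ = V} from ⟨hx, h2⟩)
    simp only [mem_ofPred_eq] at this
    linarith

theorem tube {Φ : ℂ × ℂ → ℂ} (hΦ : Continuous Φ) {s0 : ℂ} {K : Set ℂ} (hK : IsCompact K)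
    (h : ∀ x ∈ K, Φ (s0, x) ≠ 0) : ∃ c > 0, ∀ᶠ s in 𝓝 s0, ∀ x ∈ K, c ≤ ‖Φ (s, x)‖ := by
  have hc : ContinuousOn (fun x => ‖Φ (s0, x)‖) K := by fun_prop
  obtain ⟨c, hc0, hc⟩ : ∃ c > 0, ∀ x ∈ K, c < ‖Φ (s0, x)‖ := by
    rcases K.eq_empty_or_nonempty with rfl | hne
    · exact ⟨1, one_pos, by simp⟩
    · obtain ⟨x, hx, hmin⟩ := hK.exists_isMinOn hne hc
      have : 0 < ‖Φ (s0, x)‖ := norm_pos_iff.2 (h x hx)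
      refine ⟨‖Φ (s0, x)‖ / 2, by positivity, fun y hy => ?_⟩
      have := hmin hy
      simp only [mem_ofPred_eq] at this
      linarith
  refine ⟨c, hc0, ?_⟩
  refine hK.eventually_forall_of_forall_eventually fun x hx => ?_
  have := (hΦ.norm.continuousAt (x := (s0, x))).eventually_const_lt (hc x hx)
  exact this.mono fun p hp => hp.le

/-- fixed points of `F P s0 m` are isolated -/
theorem isolated_fix (hP : 2 ≤ P.natDegree) {m : ℕ} (hm : 1 ≤ m) (s0 x0 : ℂ) {r0 : ℝ}
    (hr0 : 0 < r0) : ∃ r > 0, r < r0 ∧ ∀ x ∈ closedBall x0 r, F P s0 m x = x → x = x0 := by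
  have hne : pF P s0 m - Polynomial.X ≠ 0 := by
    intro h
    have := pF_sub_natDegree hP s0 hm
    rw [h, Polynomial.natDegree_zero] at this
    have : 0 < P.natDegree ^ m := by positivity
    omega
  have hfin : {x | F P s0 m x = x}.Finite := by
    refine ((pF P s0 m - Polynomial.X).roots.toFinset.finite_toSet).subset fun x hx => ?_
    simp only [Finset.mem_coe, Multiset.mem_toFinset]
    rw [Polynomial.mem_roots hne, Polynomial.IsRoot, Polynomial.eval_sub, Polynomial.eval_X,
      pF_eval, sub_eq_zero]
    exact hx
  have h1 : ({x | F P s0 m x = x} \ {x0})ᶜ ∈ 𝓝 x0 :=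
    (hfin.subset sdiff_subset).isClosed.isOpen_compl.mem_nhds (by simp)
  obtain ⟨r, hr, hball⟩ := Metric.mem_nhds_iff.1 h1
  refine ⟨min r r0 / 2, by positivity, ?_, fun x hx hfx => ?_⟩
  · linarith [min_le_right r r0]
  · by_contra hxx
    refine hball (?_ : x ∈ ball x0 r) ⟨hfx, hxx⟩
    have := mem_closedBall.1 hx
    have : 0 < min r r0 := by positivity
    rw [mem_ball]; linarith [min_le_left r r0]

/-- persistence of fixed points -/
theorem near_root (hP : 2 ≤ P.natDegree) {m : ℕ} (hm : 1 ≤ m) {s0 x0 : ℂ}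
    (h : F P s0 m x0 = x0) {r0 : ℝ} (hr0 : 0 < r0) :
    ∀ᶠ s in 𝓝 s0, ∃ x ∈ closedBall x0 r0, F P s m x = x := by
  obtain ⟨r, hr, hrr, hiso⟩ := isolated_fix hP hm s0 x0 hr0
  have hΦ : Continuous (fun p : ℂ × ℂ => F P p.1 m p.2 - p.2) :=
    (continuous_F P m).sub continuous_snd
  obtain ⟨c, hc, htube⟩ := tube hΦ (s0 := s0) (isCompact_sphere x0 r) (fun x hx h0 => by
    have := hiso x (sphere_subset_closedBall hx) (sub_eq_zero.1 h0)
    rw [this] at hx; simp at hx; exact hr.ne hx)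
  have hc2 : Continuous (fun s => ‖F P s m x0 - x0‖) :=
    (hΦ.comp (by fun_prop : Continuous (fun s : ℂ => (s, x0)))).norm
  have h2 : ∀ᶠ s in 𝓝 s0, ‖F P s m x0 - x0‖ < c / 4 := by
    refine hc2.continuousAt.eventually_lt_const ?_
    simp only [h]; simpa using hc
  filter_upwards [htube, h2] with s hs1 hs2
  have hdiff : Differentiable ℂ (fun z => F P s m z - z) := fun z =>
    (hasDerivAt_F m z).differentiableAt.sub differentiableAt_id
  have hsph : ∀ z ∈ sphere x0 r, c / 2 ≤ ‖(F P s m z - z) - (F P s m x0 - x0)‖ := by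
    intro z hz
    have := hs1 z hz
    have h3 := norm_sub_norm_le (F P s m z - z) (F P s m x0 - x0)
    linarith
  have hnt : ∃ᶠ z in 𝓝 x0, F P s m z - z ≠ F P s m x0 - x0 := by
    by_contra hcon
    rw [not_frequently] at hcon
    have hev : (fun z => F P s m z - z) =ᶠ[𝓝 x0] fun _ => F P s m x0 - x0 := by
      filter_upwards [hcon] with z hz
      push Not at hz; exact hz
    have := AnalyticOnNhd.eqOn_of_preconnected_of_eventuallyEq
      (U := univ) (fun z _ => hdiff.analyticAt z) (fun z _ => analyticAt_const) isPreconnected_univ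
      (mem_univ x0) hev
    have hz : x0 + (r : ℂ) ∈ sphere x0 r := by
      simp [abs_of_pos hr]
    have h4 := hsph _ hz
    have h5 := this (mem_univ (x0 + (r : ℂ)))
    simp only at h5
    rw [h5, sub_self, norm_zero] at h4
    linarith
  have := DiffContOnCl.ball_subset_image_closedBall (f := fun z => F P s m z - z)
    hdiff.diffContOnCl hr hsph hnt
  have h0 : (0 : ℂ) ∈ ball (F P s m x0 - x0) (c / 2 / 2) := by
    rw [mem_ball, dist_comm, dist_zero_right]; linarith
  obtain ⟨x, hx, hx0⟩ := this h0
  exact ⟨x, closedBall_subset_closedBall hrr.le hx, sub_eq_zero.1 hx0⟩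

/-- a local branch of simple fixed points -/
theorem branch {m : ℕ} {s0 x0 : ℂ} (h : F P s0 m x0 = x0) (hD : D P s0 m x0 ≠ 1) :
    ∃ x : ℂ → ℂ, AnalyticAt ℂ x s0 ∧ x s0 = x0 ∧ (∀ᶠ s in 𝓝 s0, F P s m (x s) = x s) ∧
      AnalyticAt ℂ (fun s => D P s m (x s)) s0 := by
  obtain ⟨x, hx, hx0, hev⟩ := ift (G := fun p : ℂ × ℂ => F P p.1 m p.2 - p.2) (s0 := s0) (x0 := x0)
    ((analyticAt_F P m _).sub analyticAt_snd) (sub_eq_zero.2 h)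
    ((hasDerivAt_F m x0).sub (hasDerivAt_id x0)) (sub_ne_zero.2 hD)
  refine ⟨x, hx, hx0, ?_, ?_⟩
  · filter_upwards [hev] with s hs
    exact sub_eq_zero.1 hs
  · exact AnalyticAt.comp (g := fun p : ℂ × ℂ => D P p.1 m p.2) (f := fun s => (s, x s))
      (analyticAt_D P m _) (analyticAt_id.prod hx)

theorem lemmaO (hP : 2 ≤ P.natDegree) {m : ℕ} (hm : 1 ≤ m) (h0 : F P 0 m 0 = 0)
    (hD0 : D P 0 m 0 = 1) {η : ℝ} (hη : 0 < η) :
    ∃ s x : ℂ, ‖s‖ < η ∧ ‖x‖ < η ∧ F P s m x = x ∧ ‖D P s m x‖ = 1 ∧ D P s m x ≠ 1 := by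
  by_contra hcon
  push Not at hcon
  have hfin := finite_mult hP hm (ω := 1) (by simp)
  obtain ⟨r, hr, hrη, hiso⟩ := isolated_fix hP hm 0 0 hη
  have hΦ : Continuous (fun p : ℂ × ℂ => F P p.1 m p.2 - p.2) :=
    (continuous_F P m).sub continuous_snd
  obtain ⟨c, hc, htube⟩ := tube hΦ (s0 := 0) (isCompact_sphere (0 : ℂ) r) (fun x hx h0 => by
    have := hiso x (sphere_subset_closedBall hx) (sub_eq_zero.1 h0)
    rw [this] at hx; simp at hx; exact hr.ne hx)
  have hbad : ({s : ℂ | ∃ x, F P s m x = x ∧ D P s m x = 1} \ {0})ᶜ ∈ 𝓝 (0 : ℂ) :=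
    (hfin.subset sdiff_subset).isClosed.isOpen_compl.mem_nhds (by simp)
  obtain ⟨A1, hA1, hball⟩ := Metric.eventually_nhds_iff_ball.1 (htube.and hbad)
  set A := min A1 η / 2 with hA
  have hA0 : 0 < A := by positivity
  have hAA1 : A < A1 := by
    have : 0 < min A1 η := by positivity
    linarith [min_le_left A1 η]
  have hAη : A < η := by
    have : 0 < min A1 η := by positivity
    linarith [min_le_right A1 η]
  have hsph : ∀ s x : ℂ, ‖s‖ ≤ A → ‖x‖ ≤ r → F P s m x = x → ‖x‖ < r := by
    intro s x hs hx hF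
    refine lt_of_le_of_ne hx fun hxr => ?_
    have := (hball s (by rw [mem_ball_zero_iff]; linarith)).1 x (by simpa using hxr)
    simp only [hF, sub_self, norm_zero] at this
    linarith
  have hnn : ∀ s x : ℂ, s ≠ 0 → ‖s‖ ≤ A → ‖x‖ ≤ r → F P s m x = x → ‖D P s m x‖ ≠ 1 := by
    intro s x hs0 hs hx hF hD
    have h1 := hcon s x (by linarith) (by linarith) hF hD
    exact (hball s (by rw [mem_ball_zero_iff]; linarith)).2 ⟨⟨x, hF, h1⟩, hs0⟩
  let K0 : Set (ℂ × ℂ) := (closedBall 0 A ×ˢ closedBall 0 r) ∩ {p | F P p.1 m p.2 - p.2 = 0}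
  have hK0 : IsCompact K0 := ((isCompact_closedBall 0 A).prod (isCompact_closedBall 0 r)).inter_right
    (isClosed_eq hΦ continuous_const)
  have hDc := continuous_D P m
  have key : ∀ (f : ℂ → ℂ) (C : Set ℂ), IsClosed C → (∀ z ∈ C, AnalyticAt ℂ f z) →
      (∀ z ∈ C, ‖z‖ ≠ 1 → C ∈ 𝓝 z) → (∀ z ∈ C, ‖z‖ ≠ 1 → ‖f z‖ < 1) →
      ∃ M < 1, ∀ p ∈ K0, p.1 ≠ 0 → D P p.1 m p.2 ∈ C → ‖f (D P p.1 m p.2)‖ ≤ M := by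
    intro f C hC hf hCn hf1
    let K : Set (ℂ × ℂ) := K0 ∩ (fun p => D P p.1 m p.2) ⁻¹' C
    have hK : IsCompact K := hK0.inter_right (hC.preimage hDc)
    have hfK : ContinuousOn (fun p : ℂ × ℂ => f (D P p.1 m p.2)) K := fun p hp =>
      ((hf _ hp.2).continuousAt.comp (f := fun p : ℂ × ℂ => D P p.1 m p.2)
        hDc.continuousAt).continuousWithinAt
    have hK1 : ∀ p ∈ K0, p.1 ≠ 0 → ‖D P p.1 m p.2‖ ≠ 1 := fun p hp hp0 =>
      hnn p.1 p.2 hp0 (mem_closedBall_zero_iff.1 hp.1.1) (mem_closedBall_zero_iff.1 hp.1.2)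
        (sub_eq_zero.1 hp.2)
    obtain ⟨M, hM1, hM0, hM⟩ : ∃ M < 1, 0 ≤ M ∧ ∀ p ∈ K, ‖p.1‖ = A →
        ‖f (D P p.1 m p.2)‖ ≤ M := by
      have hKA : IsCompact (K ∩ {p | ‖p.1‖ = A}) :=
        hK.inter_right (isClosed_eq continuous_fst.norm continuous_const)
      rcases (K ∩ {p | ‖p.1‖ = A}).eq_empty_or_nonempty with he | hne
      · refine ⟨0, one_pos, le_rfl, fun p hp hpA => ?_⟩
        have : p ∈ K ∩ {p | ‖p.1‖ = A} := ⟨hp, hpA⟩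
        rw [he] at this; exact this.elim
      · obtain ⟨p, ⟨hp, hpA⟩, hmax⟩ := hKA.exists_isMaxOn hne (hfK.norm.mono inter_subset_left)
        have hpA : ‖p.1‖ = A := hpA
        refine ⟨‖f (D P p.1 m p.2)‖, hf1 _ hp.2 (hK1 p hp.1 ?_), norm_nonneg _,
          fun q hq hqA => hmax ⟨hq, hqA⟩⟩
        intro h; rw [h, norm_zero] at hpA; linarith
    refine ⟨M, hM1, fun p hp hp0 hpC => ?_⟩
    refine max_lemma hK hfK hM0 (fun p hp => mem_closedBall_zero_iff.1 hp.1.1.1) ?_ hM p ⟨hp, hpC⟩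
      hp0
    rintro ⟨s, x⟩ hq hq0 hqA
    simp only at hq0 hqA
    have hs0 : s ≠ 0 := norm_pos_iff.1 hq0
    have hF : F P s m x = x := sub_eq_zero.1 hq.1.2
    have hD1 : ‖D P s m x‖ ≠ 1 := hK1 _ hq.1 hs0
    obtain ⟨y, hy, hy0, hyF, hyD⟩ := branch hF (fun h => hD1 (by rw [h]; simp))
    have hfa : AnalyticAt ℂ f (D P s m x) := hf _ hq.2
    refine ⟨fun s => f (D P s m (y s)), ?_, ?_, ?_⟩
    · exact AnalyticAt.fun_comp (g := f) (f := fun s => D P s m (y s)) (by rw [hy0]; exact hfa) hyD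
    · simp only [hy0]
    · have e1 : ∀ᶠ s' in 𝓝 s, ‖s'‖ < A := continuous_norm.continuousAt.eventually_lt_const hqA
      have e2 : ∀ᶠ s' in 𝓝 s, ‖y s'‖ < r := by
        refine hy.continuousAt.norm.eventually_lt_const ?_
        simp only [hy0]
        exact hsph s x hqA.le (mem_closedBall_zero_iff.1 hq.1.1.2) hF
      have e3 : ∀ᶠ s' in 𝓝 s, D P s' m (y s') ∈ C := by
        refine hyD.continuousAt ?_
        rw [hy0]
        exact hCn _ hq.2 hD1
      filter_upwards [e1, e2, e3, hyF] with s' h1 h2 h3 h4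
      exact ⟨y s', ⟨⟨⟨mem_closedBall_zero_iff.2 h1.le, mem_closedBall_zero_iff.2 h2.le⟩,
        sub_eq_zero.2 h4⟩, h3⟩, rfl⟩
  obtain ⟨M1, hM1, hk1⟩ := key id {z | ‖z‖ ≤ 1} (isClosed_le continuous_norm continuous_const)
    (fun z _ => analyticAt_id)
    (fun z hz hz1 => by
      filter_upwards [continuous_norm.continuousAt.eventually_lt_const (lt_of_le_of_ne hz hz1)]
        with w hw using hw.le)
    (fun z hz hz1 => lt_of_le_of_ne hz hz1)
  obtain ⟨M2, hM2, hk2⟩ := key (fun z => z⁻¹) {z | 1 ≤ ‖z‖}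
    (isClosed_le continuous_const continuous_norm)
    (fun z hz => analyticAt_id.inv (by
      intro h
      have h1 : (1 : ℝ) ≤ ‖z‖ := hz
      simp only [id] at h
      rw [h] at h1; simp at h1; linarith))
    (fun z hz hz1 => by
      filter_upwards [continuous_norm.continuousAt.eventually_const_lt
        (lt_of_le_of_ne hz (Ne.symm hz1))] with w hw using hw.le)
    (fun z hz hz1 => by
      rw [norm_inv]
      exact inv_lt_one_of_one_lt₀ (lt_of_le_of_ne hz (Ne.symm hz1)))
  have hcl : ∀ᶠ p : ℂ × ℂ in 𝓝 ((0 : ℂ), (0 : ℂ)), M1 < ‖D P p.1 m p.2‖ ∧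
      M2 < ‖(D P p.1 m p.2)⁻¹‖ := by
    refine (hDc.norm.continuousAt.eventually_const_lt (by simpa [hD0])).and ?_
    refine ((hDc.continuousAt.inv₀ (by simp [hD0])).norm).eventually_const_lt (by simpa [hD0])
  obtain ⟨ρ, hρ, hρb⟩ := Metric.eventually_nhds_iff_ball.1 hcl
  have hnr := near_root hP hm h0 (r0 := min (ρ / 2) r) (by positivity)
  obtain ⟨δ, hδ, hδb⟩ := Metric.eventually_nhds_iff_ball.1 hnr
  set t : ℝ := min (min δ ρ) A / 2 with ht
  have ht0 : 0 < t := by positivity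
  have ht1 : t < δ ∧ t < ρ ∧ t < A := by
    have h1 := min_le_left (min δ ρ) A
    have h2 := min_le_right (min δ ρ) A
    have h3 := min_le_left δ ρ
    have h4 := min_le_right δ ρ
    refine ⟨?_, ?_, ?_⟩ <;> linarith
  have htn : ‖(t : ℂ)‖ = t := by rw [Complex.norm_real, Real.norm_of_nonneg ht0.le]
  obtain ⟨x, hx, hFx⟩ := hδb t (by rw [mem_ball_zero_iff, htn]; exact ht1.1)
  rw [mem_closedBall_zero_iff] at hx
  have hK0x : ((t : ℂ), x) ∈ K0 := ⟨⟨mem_closedBall_zero_iff.2 (by rw [htn]; linarith),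
    mem_closedBall_zero_iff.2 (hx.trans (min_le_right _ _))⟩, sub_eq_zero.2 hFx⟩
  have htne : (t : ℂ) ≠ 0 := by exact_mod_cast ht0.ne'
  obtain ⟨g1, g2⟩ := hρb (t, x) (by
    rw [mem_ball, dist_eq_norm, Prod.norm_def, max_lt_iff]
    simp only [Prod.fst_sub, Prod.snd_sub, sub_zero, htn]
    exact ⟨ht1.2.1, by linarith [min_le_left (ρ / 2) r]⟩)
  rcases le_total ‖D P (t : ℂ) m x‖ 1 with h | h
  · have := hk1 _ hK0x htne h
    simp only [id] at this
    simp only at g1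
    linarith
  · have := hk2 _ hK0x htne h
    simp only at this g2
    linarith

end PB


namespace PB

variable {P : Polynomial ℂ}

theorem infinite_of_eventually {s0 : ℂ} {p : ℂ → Prop} (h : ∀ᶠ s in 𝓝 s0, p s) :
    {s | p s}.Infinite := infinite_of_mem_nhds s0 h

theorem lemmaN (hP : 2 ≤ P.natDegree) {m : ℕ} (hm : 1 ≤ m) {s0 x0 : ℂ} (hF : F P s0 m x0 = x0)
    (hD : ‖D P s0 m x0‖ = 1) (hD1 : D P s0 m x0 ≠ 1) {η : ℝ} (hη : 0 < η) :
    ∃ δ > 0, ∃ l : ℂ, ‖l‖ = 1 ∧ ∃ s x : ℂ → ℂ, DifferentiableOn ℂ s (ball 0 δ) ∧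
      DifferentiableOn ℂ x (ball 0 δ) ∧ InjOn s (ball 0 δ) ∧ ∀ τ ∈ ball (0 : ℂ) δ,
        ‖s τ - s0‖ < η ∧ ‖x τ - x0‖ < η ∧ F P (s τ) m (x τ) = x τ ∧
        D P (s τ) m (x τ) = l * Complex.exp τ := by
  obtain ⟨y, hy, hy0, hyF, hyD⟩ := branch hF hD1
  set L : ℂ → ℂ := fun s => D P s m (y s) with hL
  have hfin := finite_mult hP hm (ω := L s0) (by simp only [hL, hy0, hD]; exact le_rfl)
  have hnc : ¬ ∀ᶠ s in 𝓝 s0, L s = L s0 := by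
    intro h
    refine (infinite_of_eventually (h.and hyF)) (hfin.subset ?_)
    rintro s ⟨h1, h2⟩
    exact ⟨y s, h2, h1⟩
  have hopen := hyD.eventually_constant_or_nhds_le_map_nhds.resolve_left hnc
  have hder : ∀ᶠ s in 𝓝[≠] s0, deriv L s ≠ 0 := by
    refine hyD.deriv.eventually_eq_zero_or_eventually_ne_zero.resolve_left fun h => hnc ?_
    obtain ⟨ε, hε, hb⟩ := Metric.eventually_nhds_iff_ball.1 (h.and hyD.eventually_analyticAt)
    filter_upwards [ball_mem_nhds s0 hε] with s hs
    exact isOpen_ball.is_const_of_deriv_eq_zero (convex_ball s0 ε).isPreconnected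
      (fun z hz => (hb z hz).2.differentiableAt.differentiableWithinAt)
      (fun z hz => (hb z hz).1) hs (mem_ball_self hε)
  rw [eventually_nhdsWithin_iff] at hder
  have hη1 : ∀ᶠ s in 𝓝 s0, ‖s - s0‖ < η := by
    filter_upwards [ball_mem_nhds s0 hη] with s hs
    rwa [mem_ball, dist_eq_norm] at hs
  have hη2 : ∀ᶠ s in 𝓝 s0, ‖y s - x0‖ < η := by
    refine (hy.continuousAt.sub continuousAt_const).norm.eventually_lt_const ?_
    simp [hy0, hη]
  have hall := (((((hyF.and hη1).and hη2).and hy.eventually_analyticAt).and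
    hyD.eventually_analyticAt).eventually_nhds).and hder
  have himg := hopen (image_mem_map hall)
  have hθ : Tendsto (fun θ : ℝ => L s0 * Complex.exp (θ * Complex.I)) (𝓝[>] 0) (𝓝 (L s0)) := by
    have : Continuous (fun θ : ℝ => L s0 * Complex.exp (θ * Complex.I)) := by fun_prop
    have h2 := this.tendsto 0
    simp only [Complex.ofReal_zero, zero_mul, Complex.exp_zero, mul_one] at h2
    exact h2.mono_left nhdsWithin_le_nhds
  have hL0 : L s0 ≠ 0 := by
    intro h
    simp only [hL, hy0] at h
    rw [h] at hD; simp at hD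
  obtain ⟨θ, ⟨s1, hs1, hLs1⟩, hθ1⟩ := ((show ∀ᶠ θ : ℝ in 𝓝[>] 0, _ from hθ himg).and
    (Ioo_mem_nhdsGT (show (0 : ℝ) < 1 by norm_num))).exists
  obtain ⟨hs1, hder1⟩ := hs1
  have hl : ‖L s1‖ = 1 := by
    rw [hLs1, norm_mul, Complex.norm_exp_ofReal_mul_I]
    simp only [hL, hy0, hD, mul_one]
  have hne : s1 ≠ s0 := by
    intro h
    rw [h] at hLs1
    have h1 : Complex.exp (θ * Complex.I) = Complex.exp 0 := by
      rw [Complex.exp_zero]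
      exact mul_left_cancel₀ hL0 (by rw [mul_one]; exact hLs1.symm)
    have h2 := Complex.exp_inj_of_neg_pi_lt_of_le_pi (by simp; linarith [hθ1.1, Real.pi_pos])
      (by simp; linarith [hθ1.2, Real.pi_gt_three]) (by simp [Real.pi_pos])
      (by simp [Real.pi_pos.le]) h1
    have h3 := congrArg Complex.im h2
    simp at h3
    linarith [hθ1.1]
  have hLan := (hs1.self_of_nhds).2
  obtain ⟨σ, hσ, hσ0, hσe⟩ := ift (G := fun p : ℂ × ℂ => L p.2 - L s1 * Complex.exp p.1)
    (s0 := 0) (x0 := s1) (D := deriv L s1)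
    ((AnalyticAt.comp (g := L) (f := fun p : ℂ × ℂ => p.2) hLan analyticAt_snd).sub
      (analyticAt_const.mul analyticAt_fst.cexp)) (by simp)
    (hLan.differentiableAt.hasDerivAt.sub_const (L s1 * Complex.exp 0)) (hder1 hne)
  have hσc := hσ.continuousAt
  rw [ContinuousAt, hσ0] at hσc
  have hev := hσc.eventually hs1
  obtain ⟨δ, hδ, hb⟩ := Metric.eventually_nhds_iff_ball.1
    ((hev.and hσe).and hσ.eventually_analyticAt)
  have hsub : ball (0 : ℂ) (min δ 1) ⊆ ball 0 δ := ball_subset_ball (min_le_left _ _)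
  refine ⟨min δ 1, by positivity, L s1, hl, σ, fun τ => y (σ τ), ?_, ?_, ?_, ?_⟩
  · intro τ hτ
    exact (hb τ (hsub hτ)).2.differentiableAt.differentiableWithinAt
  · intro τ hτ
    have := (hb τ (hsub hτ))
    exact ((this.1.1.1.2.differentiableAt).comp τ
      this.2.differentiableAt).differentiableWithinAt
  · intro τ hτ τ' hτ' he
    have h1 := sub_eq_zero.1 (hb τ (hsub hτ)).1.2
    have h2 := sub_eq_zero.1 (hb τ' (hsub hτ')).1.2
    simp only at h1 h2
    rw [he, h2] at h1
    have h3 := mul_left_cancel₀ (norm_ne_zero_iff.1 (by rw [hl]; norm_num)) h1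
    have hb1 : ∀ w ∈ ball (0 : ℂ) (min δ 1), |w.im| < 1 := fun w hw => by
      rw [mem_ball_zero_iff] at hw
      exact (Complex.abs_im_le_norm w).trans_lt (hw.trans_le (min_le_right _ _))
    have i1 := abs_lt.1 (hb1 τ hτ)
    have i2 := abs_lt.1 (hb1 τ' hτ')
    have := Real.pi_gt_three
    exact (Complex.exp_inj_of_neg_pi_lt_of_le_pi (by linarith) (by linarith) (by linarith)
      (by linarith) h3.symm)
  · intro τ hτ
    obtain ⟨⟨⟨⟨⟨h1, h2⟩, h3⟩, h4⟩, h5⟩, h6⟩ := (hb τ (hsub hτ)).1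
    exact ⟨h2, h3, h1, sub_eq_zero.1 h6⟩

end PB


namespace PB

variable {P : Polynomial ℂ} {s : ℂ}

theorem escape (hP : 2 ≤ P.natDegree) (s : ℂ) (R' : ℝ) :
    ∃ R ≥ R', 0 < R ∧ ∀ z, R < ‖z‖ → ∀ n, R < ‖F P s n z‖ := by
  obtain ⟨T, hT, h⟩ := poly_superlinear hP 2
  refine ⟨max T (max ‖s‖ R'), le_max_of_le_right (le_max_right _ _), by positivity, ?_⟩
  intro z hz n
  induction n with
  | zero => exact hz
  | succ n ih =>
    rw [F_succ]
    have h1 := h (F P s n z) ((le_max_left _ _).trans ih.le)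
    have h2 : ‖s‖ ≤ ‖F P s n z‖ := ((le_max_left _ _).trans (le_max_right _ _)).trans ih.le
    have h3 := norm_sub_norm_le (P.eval (F P s n z)) (-s)
    rw [sub_neg_eq_add, norm_neg] at h3
    linarith

/-- inverse branches on discs free of critical values -/
theorem inverse_branch (p : Polynomial ℂ) {σ w : ℂ} {r : ℝ} (hr : 0 < r) (hw : p.eval w = σ)
    (hcrit : ∀ z, p.derivative.eval z = 0 → p.eval z ∉ ball σ r) :
    ∃ g : ℂ → ℂ, g σ = w ∧ DifferentiableOn ℂ g (ball σ r) ∧ (∀ z ∈ ball σ r, p.eval (g z) = z) ∧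
      deriv g σ = (p.derivative.eval w)⁻¹ := by
  have hcov : IsCoveringMapOn p.eval (ball σ r) := p.isCoveringMapOn_eval.mono (by
    rintro x hx ⟨z, hz, rfl⟩
    exact hcrit z hz hx)
  have hmem : σ ∈ ball σ r := mem_ball_self hr
  haveI : ContractibleSpace (ball σ r) := (convex_ball σ r).contractibleSpace ⟨σ, hmem⟩
  haveI : LocallyPathConnectedSpace (ball σ r) := isOpen_ball.locallyPathConnectedSpace
  obtain ⟨G, ⟨hG0, hG⟩, -⟩ := hcov.isCoveringMap_restrictPreimage.existsUnique_continuousMap_lifts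
    (ContinuousMap.id (ball σ r)) ⟨σ, hmem⟩ ⟨w, by simp [hw, hr]⟩ (by
      ext; simp [hw])
  classical
  let g : ℂ → ℂ := fun z => if h : z ∈ ball σ r then (G ⟨z, h⟩ : ℂ) else 0
  have hg : ∀ z (h : z ∈ ball σ r), g z = G ⟨z, h⟩ := fun z h => dif_pos h
  have hfg : ∀ z ∈ ball σ r, p.eval (g z) = z := by
    intro z h
    have := congrFun hG ⟨z, h⟩
    have h2 := congrArg Subtype.val this
    rw [hg z h]
    exact h2
  have hgc : ContinuousOn g (ball σ r) := by
    rw [continuousOn_iff_continuous_domRestrict]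
    have : (ball σ r).domRestrict g = fun z => (G z : ℂ) := by
      funext z; exact hg z z.2
    rw [this]
    exact continuous_subtype_val.comp G.continuous
  have hder : ∀ z ∈ ball σ r, HasDerivAt g (p.derivative.eval (g z))⁻¹ z := by
    intro z hz
    refine HasDerivAt.of_local_left_inverse (f := fun x => p.eval x)
      (hgc.continuousAt (isOpen_ball.mem_nhds hz)) (p.hasDerivAt _) ?_ ?_
    · intro h
      refine hcrit _ h ?_
      rw [hfg z hz]; exact hz
    · filter_upwards [isOpen_ball.mem_nhds hz] with y hy using hfg y hy
  have hgσ : g σ = w := by rw [hg σ hmem, hG0]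
  refine ⟨g, hgσ, fun z hz => (hder z hz).differentiableAt.differentiableWithinAt, hfg, ?_⟩
  rw [(hder σ hmem).deriv, hgσ]

theorem fatou (hP : 2 ≤ P.natDegree) {k : ℕ} {σ : ℂ} (h : F P s k σ = σ)
    (hD : ‖D P s k σ‖ < 1) : ∃ c, P.derivative.eval c = 0 ∧
      ∃ i, Tendsto (fun n => F P s (k * n + i) c) atTop (𝓝 σ) := by
  obtain ⟨q, hq1, hq0, r, hr, -, hev⟩ := contraction h hD one_pos
  obtain ⟨hmap, hlip⟩ := hev.self_of_nhds
  have hconv : ∀ w ∈ closedBall σ r, Tendsto (fun n => F P s (k * n) w) atTop (𝓝 σ) := by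
    intro w hw
    have hb : ∀ n, F P s (k * n) w ∈ closedBall σ r ∧ ‖F P s (k * n) w - σ‖ ≤ q ^ n * ‖w - σ‖ := by
      intro n
      induction n with
      | zero => simpa [F_zero] using hw
      | succ n ih =>
        have e : F P s (k * (n + 1)) w = F P s k (F P s (k * n) w) := by
          rw [← F_add]; ring_nf
        rw [e]
        refine ⟨hmap _ ih.1, ?_⟩
        have := hlip _ ih.1 σ (mem_closedBall_self hr.le)
        rw [h] at this
        rw [pow_succ]
        nlinarith [ih.2]
    rw [tendsto_iff_norm_sub_tendsto_zero]
    refine squeeze_zero (fun _ => norm_nonneg _) (fun n => (hb n).2) ?_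
    simpa using (tendsto_pow_atTop_nhds_zero_of_lt_one hq0 hq1).mul_const ‖w - σ‖
  by_contra hcon
  have hno : ∀ c, P.derivative.eval c = 0 → ∀ j, F P s j c ∉ ball σ r := by
    intro c hc j hj
    refine hcon ⟨c, hc, j, ?_⟩
    simp only [F_add]
    exact hconv _ (ball_subset_closedBall hj)
  have hnoc : ∀ N z, D P s N z = 0 → F P s N z ∉ ball σ r := by
    intro N z hz
    obtain ⟨i, hi, hc⟩ := eq_crit_of_D hz
    have := hno _ hc (N - i)
    rwa [← F_add, Nat.sub_add_cancel hi.le] at this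
  have hD0 : D P s k σ ≠ 0 := fun h0 => hnoc k σ h0 (by rw [h]; exact mem_ball_self hr)
  obtain ⟨R, hR, hR0, hesc⟩ := escape hP s (‖σ‖ + r)
  have hbound : ∀ N, ‖(D P s k σ)⁻¹‖ ^ N ≤ R / (r / 2) := by
    intro N
    have hf := F_mul_fix h N
    obtain ⟨g, hg0, hgd, hfg, hgder⟩ := inverse_branch (pF P s (k * N)) (σ := σ) (w := σ) hr
      (by rw [pF_eval, hf]) (by
        intro z hz
        rw [pF_derivative_eval] at hz
        rw [pF_eval]
        exact hnoc _ z hz)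
    rw [pF_derivative_eval, D_mul_fix h] at hgder
    have hsub : closedBall σ (r / 2) ⊆ ball σ r := closedBall_subset_ball (by linarith)
    have := Complex.norm_deriv_le_of_forall_mem_sphere_norm_le (c := σ) (R := r / 2) (C := R)
      (f := g) (by positivity)
      ((hgd.mono (by rw [closure_ball _ (by positivity)]; exact hsub)).diffContOnCl) (by
        intro z hz
        by_contra hlt
        push Not at hlt
        have hz' := hsub (sphere_subset_closedBall hz)
        have h1 := hesc _ hlt (k * N)
        rw [← pF_eval, hfg z hz'] at h1
        have h2 := norm_sub_norm_le z σ
        rw [mem_ball, dist_eq_norm] at hz'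
        linarith)
    rw [hgder, norm_inv, norm_pow] at this
    rw [norm_inv, inv_pow]
    exact this
  have h1 : 1 < ‖(D P s k σ)⁻¹‖ := by
    rw [norm_inv]
    exact (one_lt_inv₀ (norm_pos_iff.2 hD0)).2 hD
  obtain ⟨N, hN⟩ := pow_unbounded_of_one_lt (R / (r / 2)) h1
  exact absurd (hbound N) (not_le.2 hN)

end PB


namespace PB

theorem re_inv_ge {μ : ℂ} (h : 1 ≤ ‖μ‖) (h1 : μ ≠ 1) : -(1 / 2) ≤ ((μ - 1)⁻¹).re := by
  rw [Complex.inv_re]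
  have hpos : 0 < Complex.normSq (μ - 1) := Complex.normSq_pos.2 (sub_ne_zero.2 h1)
  rw [le_div_iff₀ hpos]
  have h2 : 1 ≤ Complex.normSq μ := by
    rw [Complex.normSq_eq_norm_sq]; nlinarith
  rw [Complex.normSq_apply] at *
  simp only [Complex.sub_re, Complex.sub_im, Complex.one_re, Complex.one_im] at *
  nlinarith

open Polynomial in
theorem partial_fractions {p : ℂ[X]} (hdeg : 1 ≤ p.natDegree)
    (hs : ∀ a, p.eval a = 0 → p.derivative.eval a ≠ 0) {z : ℂ} (hz : p.eval z ≠ 0) :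
    (p.eval z)⁻¹ = ∑ a ∈ p.roots.toFinset, (p.derivative.eval a)⁻¹ * (z - a)⁻¹ := by
  classical
  have hp0 : p ≠ 0 := by rintro rfl; simp at hdeg
  set S := p.roots.toFinset with hS
  have hmem : ∀ a, a ∈ S ↔ p.eval a = 0 := fun a => by
    rw [hS, Multiset.mem_toFinset, mem_roots hp0, IsRoot]
  have hnd : p.roots.Nodup := by
    rw [Multiset.nodup_iff_count_le_one]
    intro a
    rw [count_roots]
    by_contra h
    push Not at h
    have := (one_lt_rootMultiplicity_iff_isRoot hp0).1 h
    exact hs a this.1 this.2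
  have hprod : p = C p.leadingCoeff * Lagrange.nodal S id := by
    conv_lhs => rw [(IsAlgClosed.splits p).eq_prod_roots]
    congr 1
    rw [Lagrange.nodal, Finset.prod, hS, Multiset.toFinset_val, hnd.dedup]
    rfl
  have hne : S.Nonempty := by
    rw [Finset.nonempty_iff_ne_empty]
    intro h
    rw [h] at hprod
    rw [hprod] at hdeg
    simp at hdeg
  have hzn : ∀ i ∈ S, z ≠ id i := by
    rintro i hi rfl
    exact hz ((hmem _).1 hi)
  have h1 := Lagrange.eval_interpolate_not_at_node (s := S) (v := id) (x := z) 1 hzn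
  rw [Lagrange.interpolate_one (Function.injective_id.injOn) hne, eval_one] at h1
  have hl : p.leadingCoeff ≠ 0 := leadingCoeff_ne_zero.2 hp0
  have hn0 : eval z (Lagrange.nodal S id) ≠ 0 := fun h => by
    rw [h, zero_mul] at h1; exact one_ne_zero h1
  have e1 : p.eval z = p.leadingCoeff * eval z (Lagrange.nodal S id) := by
    conv_lhs => rw [hprod]
    rw [eval_mul, eval_C]
  have e2 : ∀ a, p.derivative.eval a =
      p.leadingCoeff * eval a (derivative (Lagrange.nodal S id)) := by
    intro a
    conv_lhs => rw [hprod]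
    rw [derivative_C_mul, eval_mul, eval_C]
  have e3 : (eval z (Lagrange.nodal S id))⁻¹ = ∑ i ∈ S, Lagrange.nodalWeight S id i * (z - i)⁻¹ := by
    refine inv_eq_of_mul_eq_one_right ?_
    rw [h1]
    simp
  rw [e1, mul_inv, e3, Finset.mul_sum]
  refine Finset.sum_congr rfl fun a ha => ?_
  rw [Lagrange.nodalWeight_eq_eval_derivative_nodal ha, e2, mul_inv, mul_assoc]
  rfl

variable {P : Polynomial ℂ}

theorem index_bound (hP : 2 ≤ P.natDegree) {N : ℕ} (hN : 1 ≤ N) {s x0 : ℂ} {r c : ℝ} (hr : 0 < r)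
    (hc : 0 < c) (hsph : ∀ z ∈ sphere x0 r, c ≤ ‖F P s N z - z‖)
    (hsimple : ∀ y, F P s N y = y → D P s N y ≠ 1) {x : ℂ} (hx : x ∈ ball x0 r)
    (hFx : F P s N x = x)
    (hrep : ∀ y ∈ ball x0 r, F P s N y = y → y ≠ x → 1 ≤ ‖D P s N y‖) :
    ((D P s N x - 1)⁻¹).re ≤ r / c + P.natDegree ^ N := by
  classical
  set p := pF P s N - Polynomial.X with hp
  have hpd : p.natDegree = P.natDegree ^ N := pF_sub_natDegree hP s hN
  have hpdeg : 1 ≤ p.natDegree := by rw [hpd]; exact Nat.one_le_pow _ _ (by omega)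
  have hpe : ∀ z, p.eval z = F P s N z - z := fun z => by simp [hp, pF_eval]
  have hpD : ∀ z, p.derivative.eval z = D P s N z - 1 := fun z => by simp [hp, pF_derivative_eval]
  have hp0 : p ≠ 0 := by rintro h; rw [h] at hpdeg; simp at hpdeg
  set S := p.roots.toFinset with hS
  have hmem : ∀ a, a ∈ S ↔ F P s N a = a := fun a => by
    rw [hS, Multiset.mem_toFinset, Polynomial.mem_roots hp0, Polynomial.IsRoot, hpe, sub_eq_zero]
  have hpne : ∀ z ∈ sphere x0 r, p.eval z ≠ 0 := fun z hz h => by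
    have := hsph z hz
    rw [← hpe, h, norm_zero] at this; linarith
  have hpf : ∀ z ∈ sphere x0 r, (p.eval z)⁻¹ = ∑ a ∈ S, (D P s N a - 1)⁻¹ * (z - a)⁻¹ := by
    intro z hz
    rw [partial_fractions hpdeg (fun a ha => ?_) (hpne z hz)]
    · simp only [hpD]; rfl
    · rw [hpD, sub_ne_zero]
      exact hsimple a (by rw [hpe] at ha; exact sub_eq_zero.1 ha)
  have hnsph : ∀ a ∈ S, a ∉ sphere x0 r := fun a ha h => by
    refine hpne a h ?_
    rw [hpe, (hmem a).1 ha, sub_self]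
  have hcint : ∀ a ∈ S, (∮ z in C(x0, r), (D P s N a - 1)⁻¹ * (z - a)⁻¹) =
      if a ∈ ball x0 r then (D P s N a - 1)⁻¹ * (2 * Real.pi * Complex.I) else 0 := by
    intro a ha
    rw [circleIntegral.integral_const_mul]
    split_ifs with h
    · rw [circleIntegral.integral_sub_inv_of_mem_ball h]
    · have hcb : a ∉ closedBall x0 r := fun h' => by
        rcases (mem_closedBall.1 h').lt_or_eq with h2 | h2
        · exact h h2
        · exact hnsph a ha h2
      rw [DiffContOnCl.circleIntegral_eq_zero hr.le, mul_zero]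
      refine DifferentiableOn.diffContOnCl ?_
      rw [closure_ball _ hr.ne']
      intro z hz
      refine ((differentiableAt_id.sub_const a).inv ?_).differentiableWithinAt
      rw [sub_ne_zero]; rintro rfl; exact hcb hz
  have hI : (∮ z in C(x0, r), (p.eval z)⁻¹) =
      (2 * Real.pi * Complex.I) * ∑ a ∈ S.filter (· ∈ ball x0 r), (D P s N a - 1)⁻¹ := by
    rw [circleIntegral.integral_congr hr.le hpf, circleIntegral.integral_fun_sum,
      Finset.sum_congr rfl hcint, ← Finset.sum_filter, Finset.mul_sum]
    · exact Finset.sum_congr rfl fun a _ => mul_comm _ _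
    · intro a ha
      refine ContinuousOn.circleIntegrable hr.le ?_
      refine continuousOn_const.mul ((continuousOn_id.sub continuousOn_const).inv₀ ?_)
      intro z hz
      refine sub_ne_zero.2 ?_
      rintro rfl
      exact hnsph _ ha hz
  have hb := circleIntegral.norm_two_pi_i_inv_smul_integral_le_of_norm_le_const (c := x0)
    (f := fun z => (p.eval z)⁻¹) (C := c⁻¹) hr.le (by
      intro z hz
      rw [norm_inv, hpe]
      exact inv_anti₀ hc (hsph z hz))
  rw [hI, smul_eq_mul, inv_mul_cancel_left₀ Complex.two_pi_I_ne_zero, ← div_eq_mul_inv] at hb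
  set T := S.filter (· ∈ ball x0 r) with hT
  have hxT : x ∈ T := Finset.mem_filter.2 ⟨(hmem x).2 hFx, hx⟩
  have hre := (Complex.re_le_norm _).trans hb
  rw [← Finset.add_sum_erase _ _ hxT, Complex.add_re, Complex.re_sum] at hre
  have h3 : ∑ a ∈ T.erase x, (-(1 / 2) : ℝ) ≤ ∑ a ∈ T.erase x, ((D P s N a - 1)⁻¹).re := by
    refine Finset.sum_le_sum fun a ha => ?_
    obtain ⟨ha1, ha2⟩ := Finset.mem_erase.1 ha
    obtain ⟨ha3, ha4⟩ := Finset.mem_filter.1 ha2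
    have hfa := (hmem a).1 ha3
    exact re_inv_ge (hrep a ha4 hfa ha1) (hsimple a hfa)
  rw [Finset.sum_const, nsmul_eq_mul] at h3
  have h4 : (T.erase x).card ≤ P.natDegree ^ N := by
    calc (T.erase x).card ≤ S.card := Finset.card_le_card
          ((Finset.erase_subset _ _).trans (Finset.filter_subset _ _))
      _ ≤ p.roots.card := Multiset.toFinset_card_le _
      _ ≤ p.natDegree := p.card_roots'
      _ = _ := hpd
  have h5 : ((T.erase x).card : ℝ) ≤ (P.natDegree : ℝ) ^ N := by exact_mod_cast h4
  have h6 : (0 : ℝ) ≤ ((T.erase x).card : ℝ) := by positivity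
  linarith

theorem index_lemma (hP : 2 ≤ P.natDegree) {N : ℕ} (hN : 1 ≤ N) {ι : Type*} {l : Filter ι}
    {s x : ι → ℂ} {s0 x0 : ℂ} (hs : Tendsto s l (𝓝 s0)) (hx : Tendsto x l (𝓝 x0))
    (hF : ∀ᶠ i in l, F P (s i) N (x i) = x i)
    (hsimple : ∀ᶠ i in l, ∀ y, F P (s i) N y = y → D P (s i) N y ≠ 1)
    (hD : Tendsto (fun i => ((D P (s i) N (x i) - 1)⁻¹).re) l atTop) {r0 : ℝ} (hr0 : 0 < r0) :
    ∀ᶠ i in l, ∃ σ ∈ ball x0 r0, σ ≠ x i ∧ F P (s i) N σ = σ ∧ ‖D P (s i) N σ‖ < 1 := by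
  obtain ⟨r, hr, hrr, hiso⟩ := isolated_fix hP hN s0 x0 hr0
  have hΦ : Continuous (fun p : ℂ × ℂ => F P p.1 N p.2 - p.2) :=
    (continuous_F P N).sub continuous_snd
  obtain ⟨c, hc, htube⟩ := tube hΦ (s0 := s0) (isCompact_sphere x0 r) (fun x hx h0 => by
    have := hiso x (sphere_subset_closedBall hx) (sub_eq_zero.1 h0)
    rw [this] at hx; simp at hx; exact hr.ne hx)
  filter_upwards [hs.eventually htube, hx (ball_mem_nhds x0 hr), hF, hsimple,
    hD.eventually_gt_atTop (r / c + (P.natDegree : ℝ) ^ N)] with i h1 h2 h3 h4 h5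
  by_contra hcon
  push Not at hcon
  have := index_bound hP hN hr hc h1 h4 h2 h3 (fun y hy hFy hyx =>
    hcon y (ball_subset_ball hrr.le hy) hyx hFy)
  linarith

end PB


namespace PB

variable {P : Polynomial ℂ}

theorem attract_unif {s3 c σ : ℂ} {k i : ℕ}
    (hlim : Tendsto (fun n => F P s3 (k * n + i) c) atTop (𝓝 σ))
    (hF : F P s3 k σ = σ) (hD : ‖D P s3 k σ‖ < 1) (j : ℕ) :
    ∃ ε > 0, TendstoUniformlyOn (fun (n : ℕ) (s : ℂ) => F P s (j + (k * (n + 1) + i)) c -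
      F P s (j + (k * n + i)) c) 0 atTop (ball s3 ε) := by
  obtain ⟨q, hq1, hq0, r, hr, -, hev⟩ := contraction hF hD one_pos
  obtain ⟨n0, hn0⟩ := (hlim.eventually (ball_mem_nhds σ hr)).exists
  have hcont : Continuous (fun s => F P s (k * n0 + i) c) :=
    (continuous_F P (k * n0 + i)).comp (by fun_prop : Continuous (fun s : ℂ => (s, c)))
  have hev2 : ∀ᶠ s in 𝓝 s3, F P s (k * n0 + i) c ∈ ball σ r :=
    hcont.continuousAt (isOpen_ball.mem_nhds hn0)
  obtain ⟨ε, hε, hb⟩ := Metric.eventually_nhds_iff_ball.1 (hev.and hev2)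
  have hstep : ∀ s ∈ ball s3 ε, ∀ n, F P s (k * (n0 + n) + i) c ∈ closedBall σ r ∧
      ‖F P s (k * (n0 + n + 1) + i) c - F P s (k * (n0 + n) + i) c‖ ≤ q ^ n * (2 * r) := by
    intro s hs n
    obtain ⟨⟨hmap, hlip⟩, hin⟩ := hb s hs
    have e : ∀ n, F P s (k * (n + 1) + i) c = F P s k (F P s (k * n + i) c) := fun n => by
      rw [← F_add]; ring_nf
    have hmem : ∀ n, F P s (k * (n0 + n) + i) c ∈ closedBall σ r := by
      intro n
      induction n with
      | zero => exact ball_subset_closedBall hin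
      | succ n ih => rw [← add_assoc, e]; exact hmap _ ih
    refine ⟨hmem n, ?_⟩
    induction n with
    | zero =>
      have h1 := mem_closedBall.1 (hmem 0)
      have h2 := mem_closedBall.1 (hmem 1)
      rw [← dist_eq_norm]
      have := dist_triangle_right (F P s (k * (n0 + 0 + 1) + i) c) (F P s (k * (n0 + 0) + i) c) σ
      simp only [add_zero, pow_zero, one_mul] at *
      linarith
    | succ n ih =>
      have h1 := hlip _ (hmem (n + 1)) _ (hmem n)
      rw [e, show n0 + (n + 1) = n0 + n + 1 by ring, e (n0 + n)]
      rw [show n0 + (n + 1) = n0 + n + 1 by ring, e (n0 + n)] at h1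
      rw [e (n0 + n)] at ih
      rw [pow_succ]
      nlinarith
  have hK : IsCompact (closedBall s3 ε ×ˢ closedBall σ r) :=
    (isCompact_closedBall s3 ε).prod (isCompact_closedBall σ r)
  have huc := hK.uniformContinuousOn_of_continuous (continuous_F P j).continuousOn
  refine ⟨ε, hε, ?_⟩
  rw [Metric.tendstoUniformlyOn_iff]
  intro e he
  rw [Metric.uniformContinuousOn_iff] at huc
  obtain ⟨d, hd, huc⟩ := huc e he
  have ht : Tendsto (fun n : ℕ => q ^ n * (2 * r)) atTop (𝓝 0) := by
    simpa using (tendsto_pow_atTop_nhds_zero_of_lt_one hq0 hq1).mul_const (2 * r)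
  have hlt := (tendsto_sub_atTop_nat n0).eventually (ht.eventually_lt_const hd)
  filter_upwards [hlt, eventually_ge_atTop n0] with n hn hnn s hs
  obtain ⟨l, rfl⟩ := Nat.exists_eq_add_of_le hnn
  rw [Nat.add_sub_cancel_left] at hn
  have h1 := hstep s hs l
  have h2 := hstep s hs (l + 1)
  have hs' := ball_subset_closedBall hs
  have := huc (s, F P s (k * (n0 + l + 1) + i) c) ⟨hs', h2.1⟩ (s, F P s (k * (n0 + l) + i) c)
    ⟨hs', h1.1⟩ (by
      rw [dist_eq_norm, Prod.norm_def]
      simp only [Prod.fst_sub, Prod.snd_sub, sub_self, norm_zero]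
      exact max_lt hd (h1.2.trans_lt hn))
  rw [Pi.zero_apply, dist_zero_left]
  rw [F_add j, F_add j, ← dist_eq_norm]
  exact this

/-- local comparison of postcritical values via Schottky -/
theorem local_bound (hP : 2 ≤ P.natDegree) {U : Set ℂ} (hU : IsOpen U) {s x : ℂ → ℂ}
    (hs : DifferentiableOn ℂ s U) (hx : DifferentiableOn ℂ x U)
    (hno : ∀ t ∈ U, ∀ c, P.derivative.eval c = 0 → ∀ N, F P (s t) (N + 1) c ≠ x t)
    {t0 : ℂ} (ht0 : t0 ∈ U) : ∃ ρ > 0, ∀ M : ℝ, ∃ C : ℝ, ∀ c, P.derivative.eval c = 0 → ∀ N,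
      ∀ t' ∈ ball t0 ρ, ‖F P (s t') (N + 1) c‖ ≤ M → ∀ t'' ∈ ball t0 ρ,
        ‖F P (s t'') (N + 1) c‖ ≤ C := by
  have hsa : AnalyticAt ℂ s t0 := hs.analyticAt (hU.mem_nhds ht0)
  have hxa : AnalyticAt ℂ x t0 := hx.analyticAt (hU.mem_nhds ht0)
  -- a preimage of `x t0` different from `x t0`
  obtain ⟨y0, hy0, hy0x⟩ : ∃ y, P.eval y + s t0 = x t0 ∧ y ≠ x t0 := by
    by_contra hcon
    push Not at hcon
    set p := P + Polynomial.C (s t0 - x t0) with hp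
    have hpd : p.natDegree = P.natDegree := Polynomial.natDegree_add_C
    have hp0 : p ≠ 0 := by intro h; rw [h] at hpd; simp at hpd; omega
    have hroot : ∀ y, y ∈ p.roots → y = x t0 := by
      intro y hy
      rw [Polynomial.mem_roots hp0, Polynomial.IsRoot, hp, Polynomial.eval_add,
        Polynomial.eval_C] at hy
      exact hcon y (by linear_combination hy)
    have hcard := (IsAlgClosed.splits p).natDegree_eq_card_roots
    have hrep := Multiset.eq_replicate_card.2 hroot
    have hmult : 1 < p.rootMultiplicity (x t0) := by
      rw [← Polynomial.count_roots, hrep, Multiset.count_replicate_self, ← hcard]; omega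
    obtain ⟨h1, h2⟩ := (Polynomial.one_lt_rootMultiplicity_iff_isRoot hp0).1 hmult
    simp only [hp, Polynomial.derivative_add, Polynomial.derivative_C, add_zero,
      Polynomial.IsRoot, Polynomial.eval_add, Polynomial.eval_C] at h1 h2
    refine hno t0 ht0 (x t0) h2 0 ?_
    rw [zero_add, F_one]
    linear_combination h1
  have hyd : P.derivative.eval y0 ≠ 0 := fun h => hno t0 ht0 y0 h 0 (by rw [zero_add, F_one, hy0])
  obtain ⟨y, hya, hyt0, hye⟩ := ift (G := fun p : ℂ × ℂ => P.eval p.2 + (s p.1 - x p.1))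
    (s0 := t0) (x0 := y0) (D := P.derivative.eval y0)
    (by
      have h1 : AnalyticAt ℂ (fun p : ℂ × ℂ => P.eval p.2) (t0, y0) :=
        ((contDiff_eval P).comp contDiff_snd).contDiffAt.analyticAt
      have h2 : AnalyticAt ℂ (fun p : ℂ × ℂ => s p.1) (t0, y0) :=
        AnalyticAt.comp (g := s) (f := fun p : ℂ × ℂ => p.1) hsa analyticAt_fst
      have h3 : AnalyticAt ℂ (fun p : ℂ × ℂ => x p.1) (t0, y0) :=
        AnalyticAt.comp (g := x) (f := fun p : ℂ × ℂ => p.1) hxa analyticAt_fst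
      exact h1.add (h2.sub h3))
    (by simp only; linear_combination hy0) ((P.hasDerivAt y0).add_const (s t0 - x t0)) hyd
  have hd0 : 0 < ‖y t0 - x t0‖ := by rw [hyt0]; exact norm_pos_iff.2 (sub_ne_zero.2 hy0x)
  set e := ‖y t0 - x t0‖ with he
  have hyxc : ContinuousAt (fun t => ‖y t - x t‖) t0 := (hya.continuousAt.sub hxa.continuousAt).norm
  have hev1 := hyxc.eventually_const_lt (show e / 2 < ‖y t0 - x t0‖ by linarith)
  have hev2 := hyxc.eventually_lt_const (show ‖y t0 - x t0‖ < 2 * e by linarith)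
  have hev3 := (hxa.continuousAt.norm).eventually_lt_const (show ‖x t0‖ < ‖x t0‖ + 1 by linarith)
  obtain ⟨R, hR, hb⟩ := Metric.eventually_nhds_iff_ball.1
    (((((hye.and hev1).and hev2).and hev3).and hya.eventually_analyticAt).and (hU.mem_nhds ht0))
  refine ⟨R / 8, by positivity, fun M => ?_⟩
  set B := ‖x t0‖ + 1 with hB
  obtain ⟨C, hC⟩ := schottky ((M + B) / (e / 2))
  refine ⟨C * (2 * e) + B, fun c hc N t' ht' hM t'' ht'' => ?_⟩
  have hsub : ball t' (R / 2) ⊆ ball t0 R := by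
    intro z hz
    rw [mem_ball] at *
    linarith [dist_triangle z t' t0]
  have hsubt : ball t0 (R / 8) ⊆ ball t0 R := ball_subset_ball (by linarith)
  have hyx : ∀ t ∈ ball t0 R, y t - x t ≠ 0 := fun t ht => by
    obtain ⟨⟨⟨⟨⟨h1, h2⟩, h3⟩, h4⟩, h5⟩, h6⟩ := hb t ht
    rw [← norm_pos_iff]; linarith
  set f : ℂ → ℂ := fun t => (F P (s t) (N + 1) c - x t) / (y t - x t) with hf
  have hfd : DifferentiableOn ℂ f (ball t' (R / 2)) := by
    intro t ht
    obtain ⟨⟨⟨⟨⟨h1, h2⟩, h3⟩, h4⟩, h5⟩, h6⟩ := hb t (hsub ht)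
    have hst : DifferentiableAt ℂ s t := hs.differentiableAt (hU.mem_nhds h6)
    have hxt : DifferentiableAt ℂ x t := hx.differentiableAt (hU.mem_nhds h6)
    have hFd : DifferentiableAt ℂ (fun t => F P (s t) (N + 1) c) t :=
      DifferentiableAt.comp t (g := fun p : ℂ × ℂ => F P p.1 (N + 1) p.2) (f := fun t => (s t, c))
        (analyticAt_F P (N + 1) _).differentiableAt (hst.prodMk (differentiableAt_const c))
    exact ((hFd.sub hxt).div (h5.differentiableAt.sub hxt) (hyx t (hsub ht))).differentiableWithinAt
  have hf0 : ∀ t ∈ ball t' (R / 2), f t ≠ 0 := by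
    intro t ht
    exact div_ne_zero (sub_ne_zero.2 (hno t (hb t (hsub ht)).2 c hc N)) (hyx t (hsub ht))
  have hf1 : ∀ t ∈ ball t' (R / 2), f t ≠ 1 := by
    intro t ht h
    obtain ⟨⟨⟨⟨⟨h1, h2⟩, h3⟩, h4⟩, h5⟩, h6⟩ := hb t (hsub ht)
    rw [hf] at h
    simp only at h h1
    rw [div_eq_one_iff_eq (hyx t (hsub ht))] at h
    have h7 : F P (s t) (N + 1) c = y t := by linear_combination h
    refine hno t h6 c hc (N + 1) ?_
    rw [F_succ, h7]
    linear_combination h1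
  have hfM : ‖f t'‖ ≤ (M + B) / (e / 2) := by
    obtain ⟨⟨⟨⟨⟨h1, h2⟩, h3⟩, h4⟩, h5⟩, h6⟩ := hb t' (hsubt ht')
    rw [hf]; simp only
    rw [norm_div]
    have h8 := norm_sub_le (F P (s t') (N + 1) c) (x t')
    have h9 : ‖F P (s t') (N + 1) c - x t'‖ ≤ M + B := by linarith
    gcongr
    exact (norm_nonneg _).trans h9
  have hfin := hC f t' (R / 2) (by positivity) hfd hf0 hf1 hfM t'' (by
    rw [mem_ball] at *
    have := dist_triangle_right t'' t' t0
    linarith)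
  obtain ⟨⟨⟨⟨⟨h1, h2⟩, h3⟩, h4⟩, h5⟩, h6⟩ := hb t'' (hsubt ht'')
  have h7 : F P (s t'') (N + 1) c = f t'' * (y t'' - x t'') + x t'' := by
    rw [hf]; simp only
    rw [div_mul_cancel₀ _ (hyx t'' (hsubt ht''))]; ring
  rw [h7]
  calc _ ≤ ‖f t'' * (y t'' - x t'')‖ + ‖x t''‖ := norm_add_le _ _
    _ ≤ C * (2 * e) + B := by
      rw [norm_mul]
      have := norm_nonneg (f t'')
      have h9 : ‖f t''‖ * ‖y t'' - x t''‖ ≤ C * (2 * e) := by gcongr; exact this.trans hfin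
      linarith

theorem attracted_everywhere (hP : 2 ≤ P.natDegree) {U : Set ℂ} (hU : IsOpen U)
    (hUc : IsPreconnected U) {s x : ℂ → ℂ}
    (hs : DifferentiableOn ℂ s U) (hx : DifferentiableOn ℂ x U)
    (hno : ∀ t ∈ U, ∀ c, P.derivative.eval c = 0 → ∀ N, F P (s t) (N + 1) c ≠ x t)
    {t3 : ℂ} (ht3 : t3 ∈ U) {c σ : ℂ} (hc : P.derivative.eval c = 0) {k i : ℕ} (hk : 1 ≤ k)
    (hlim : Tendsto (fun n => F P (s t3) (k * n + i) c) atTop (𝓝 σ))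
    (hF : F P (s t3) k σ = σ) (hD : ‖D P (s t3) k σ‖ < 1) (j : ℕ) :
    ∀ t ∈ U, Tendsto (fun n : ℕ => F P (s t) (j + (k * (n + 1) + i)) c -
      F P (s t) (j + (k * n + i)) c) atTop (𝓝 0) := by
  -- boundedness
  have hbd3 : ∃ M, ∀ N, ‖F P (s t3) (N + 1) c‖ ≤ M := by
    have h1 : ∀ a : ℕ, ∃ M, ∀ n, ‖F P (s t3) (a + (k * n + i)) c‖ ≤ M := by
      intro a
      have hcont : Continuous (fun z => F P (s t3) a z) :=
        (continuous_F P a).comp (by fun_prop : Continuous (fun z : ℂ => (s t3, z)))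
      have h2 := (hcont.tendsto σ).comp hlim
      obtain ⟨M, hM⟩ := (isBounded_iff_forall_norm_le.1 (isBounded_range_of_tendsto _ h2))
      refine ⟨M, fun n => ?_⟩
      rw [F_add]
      exact hM _ ⟨n, rfl⟩
    choose M hM using h1
    refine ⟨∑ a ∈ Finset.range k, |M a| + ∑ N ∈ Finset.range (i + 1), ‖F P (s t3) N c‖, fun N => ?_⟩
    have p1 : 0 ≤ ∑ a ∈ Finset.range k, |M a| := Finset.sum_nonneg fun _ _ => abs_nonneg _
    have p2 : 0 ≤ ∑ N ∈ Finset.range (i + 1), ‖F P (s t3) N c‖ :=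
      Finset.sum_nonneg fun _ _ => norm_nonneg _
    rcases Nat.lt_or_ge (N + 1) (i + 1) with h | h
    · have := Finset.single_le_sum (f := fun N => ‖F P (s t3) N c‖)
        (fun _ _ => norm_nonneg _) (Finset.mem_range.2 h)
      linarith
    · obtain ⟨l, hl⟩ := Nat.exists_eq_add_of_le (show i ≤ N + 1 by omega)
      have e : N + 1 = l % k + (k * (l / k) + i) := by
        have := Nat.mod_add_div l k
        omega
      rw [e]
      have h3 := hM (l % k) (l / k)
      have h4 := Finset.single_le_sum (f := fun a => |M a|)
        (fun _ _ => abs_nonneg _) (Finset.mem_range.2 (Nat.mod_lt l hk))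
      linarith [le_abs_self (M (l % k))]
  have hbd : ∀ t ∈ U, ∃ M, ∀ N, ‖F P (s t) (N + 1) c‖ ≤ M := by
    refine clopen_principle hUc (fun t => ∃ M, ∀ N, ‖F P (s t) (N + 1) c‖ ≤ M) ?_ ht3 hbd3
    intro t ht
    obtain ⟨ρ, hρ, hloc⟩ := local_bound hP hU hs hx hno ht
    refine ⟨ρ, hρ, fun t' ht' ⟨M, hM⟩ t'' ht'' => ?_⟩
    obtain ⟨C, hC⟩ := hloc M
    exact ⟨C, fun N => hC c hc N t' ht' (hM N) t'' ht''⟩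
  have hlb : ∀ t ∈ U, ∃ r > 0, ∃ M, ∀ N, ∀ z ∈ ball t r, ‖F P (s z) N c‖ ≤ M := by
    intro t ht
    obtain ⟨ρ, hρ, hloc⟩ := local_bound hP hU hs hx hno ht
    obtain ⟨M, hM⟩ := hbd t ht
    obtain ⟨C, hC⟩ := hloc M
    refine ⟨ρ, hρ, max C ‖c‖, fun N z hz => ?_⟩
    cases N with
    | zero => rw [F_zero]; exact le_max_right _ _
    | succ N => exact (hC c hc N t (mem_ball_self hρ) (hM N) z hz).trans (le_max_left _ _)
  have hdiff : ∀ N, DifferentiableOn ℂ (fun t => F P (s t) N c) U := by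
    intro N t ht
    exact (DifferentiableAt.comp t (g := fun p : ℂ × ℂ => F P p.1 N p.2) (f := fun t => (s t, c))
        (analyticAt_F P N _).differentiableAt ((hs.differentiableAt (hU.mem_nhds ht)).prodMk
          (differentiableAt_const c))).differentiableWithinAt
  obtain ⟨ε, hε, hunif⟩ := attract_unif hlim hF hD j
  have hst : ContinuousAt s t3 := hs.continuousOn.continuousAt (hU.mem_nhds ht3)
  obtain ⟨ε', hε', hball⟩ := Metric.eventually_nhds_iff_ball.1 (hst (ball_mem_nhds (s t3) hε))
  refine vitali hU hUc (h := fun n t => F P (s t) (j + (k * (n + 1) + i)) c -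
      F P (s t) (j + (k * n + i)) c) (fun n => (hdiff _).sub (hdiff _)) ?_ ht3 hε' ?_
  · intro t ht
    obtain ⟨r, hr, M, hM⟩ := hlb t ht
    refine ⟨r, hr, M + M, fun n z hz => (norm_sub_le _ _).trans (add_le_add (hM _ z hz) (hM _ z hz))⟩
  · rw [Metric.tendstoUniformlyOn_iff] at hunif ⊢
    intro e he
    filter_upwards [hunif e he] with n hn t ht
    exact hn (s t) (hball t ht)

end PB


namespace PB

variable {P : Polynomial ℂ}

theorem local_unique {s1 x1 : ℂ} {N : ℕ} (hD : D P s1 N x1 ≠ 1) :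
    ∃ r > 0, ∀ s ∈ ball s1 r, ∀ y ∈ ball x1 r, ∀ z ∈ ball x1 r,
      F P s N y = y → F P s N z = z → y = z := by
  set d := D P s1 N x1 with hd
  have he : 0 < ‖1 - d‖ := norm_pos_iff.2 (sub_ne_zero.2 (Ne.symm hD))
  have hcont := (continuous_D P N).continuousAt (x := (s1, x1))
  obtain ⟨r, hr, hb⟩ := Metric.continuousAt_iff.1 hcont (‖1 - d‖ / 2) (by positivity)
  refine ⟨r, hr, fun s hs y hy z hz hFy hFz => ?_⟩
  have hder : ∀ w ∈ ball x1 r, HasDerivWithinAt (fun w => F P s N w - d * w)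
      (D P s N w - d * 1) (ball x1 r) w := fun w hw =>
    ((hasDerivAt_F N w).sub ((hasDerivAt_id w).const_mul d)).hasDerivWithinAt
  have hbound : ∀ w ∈ ball x1 r, ‖D P s N w - d * 1‖ ≤ ‖1 - d‖ / 2 := by
    intro w hw
    have := hb (x := (s, w)) (by rw [Prod.dist_eq]; exact max_lt hs hw)
    rw [dist_eq_norm] at this
    rw [mul_one]
    exact this.le
  have h := (convex_ball x1 r).norm_image_sub_le_of_norm_hasDerivWithin_le hder hbound hz hy
  rw [hFy, hFz, show y - d * y - (z - d * z) = (1 - d) * (y - z) by ring, norm_mul] at h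
  have h2 : ‖y - z‖ ≤ 0 := by
    have := norm_nonneg (y - z)
    nlinarith
  exact sub_eq_zero.1 (norm_le_zero_iff.1 h2)

theorem choose_angle {l : ℂ} (hl : ‖l‖ = 1) {δ : ℝ} (hδ : 0 < δ) {K : ℕ} (hK : 1 ≤ K) :
    ∃ θ : ℝ, |θ| < δ ∧ (∃ k : ℕ, 1 ≤ k ∧ (l * Complex.exp (θ * Complex.I)) ^ k = 1) ∧
      (l * Complex.exp (θ * Complex.I)) ^ K ≠ 1 := by
  have hπ := Real.pi_pos
  have hK0 : (0 : ℝ) < K := by exact_mod_cast hK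
  set α := Complex.arg l with hα
  have hlα : l = Complex.exp (α * Complex.I) := by
    have := Complex.norm_mul_exp_arg_mul_I l
    rw [hl] at this
    simpa using this.symm
  set A := α / (2 * Real.pi) with hA
  have h1 : A < A + δ / (2 * Real.pi) := by linarith [show 0 < δ / (2 * Real.pi) by positivity]
  have h2 : A < ((⌊K * A⌋ : ℝ) + 1) / K := by
    rw [lt_div_iff₀ hK0, mul_comm]; exact Int.lt_floor_add_one _
  obtain ⟨q, hq1, hq2⟩ := exists_rat_btwn (lt_min h1 h2)
  have hq3 := hq2.trans_le (min_le_left _ _)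
  have hq4 := hq2.trans_le (min_le_right _ _)
  have hexp : l * Complex.exp (((2 * Real.pi * q - α : ℝ) : ℂ) * Complex.I) =
      Complex.exp (2 * Real.pi * Complex.I * q) := by
    rw [hlα, ← Complex.exp_add]; congr 1; push_cast; ring
  refine ⟨2 * Real.pi * q - α, ?_, ⟨q.den, q.den_pos, ?_⟩, ?_⟩
  · have e : α = 2 * Real.pi * A := by rw [hA]; field_simp
    have e2 : δ = 2 * Real.pi * (δ / (2 * Real.pi)) := by field_simp
    rw [abs_lt]
    constructor
    · rw [e]; nlinarith
    · rw [e, e2]; nlinarith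
  · rw [hexp, ← Complex.exp_nat_mul, Complex.exp_eq_one_iff]
    refine ⟨q.num, ?_⟩
    have : (q.den : ℂ) * (q : ℂ) = q.num := by
      exact_mod_cast q.den_mul_eq_num
    linear_combination (2 * Real.pi * Complex.I) * this
  · rw [hexp, ← Complex.exp_nat_mul, Ne, Complex.exp_eq_one_iff]
    rintro ⟨n, hn⟩
    have h5 : (K : ℂ) * q = n := by
      have : (2 * Real.pi * Complex.I : ℂ) ≠ 0 := Complex.two_pi_I_ne_zero
      apply mul_right_cancel₀ this
      linear_combination hn
    have h6 : (K : ℝ) * q = n := by exact_mod_cast h5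
    rw [lt_div_iff₀ hK0] at hq4
    have h7 : (⌊K * A⌋ : ℝ) < n := by
      have := Int.floor_le (K * A)
      nlinarith
    have h8 : (n : ℝ) < ⌊K * A⌋ + 1 := by linarith
    have h9 : ⌊K * A⌋ < n := by exact_mod_cast h7
    have h10 : n < ⌊K * A⌋ + 1 := by exact_mod_cast h8
    omega

end PB


namespace PB

variable {P : Polynomial ℂ}

theorem attr_fix {s c σ : ℂ} {N i' kc i : ℕ} (hN : 1 ≤ N) (hkc : 1 ≤ kc)
    (hlim : Tendsto (fun n => F P s (N * n + i') c) atTop (𝓝 σ))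
    (hd : Tendsto (fun n : ℕ => F P s ((i' + i * (kc - 1)) + (kc * (n + 1) + i)) c -
      F P s ((i' + i * (kc - 1)) + (kc * n + i)) c) atTop (𝓝 0)) : F P s kc σ = σ := by
  have e : ∀ n, (i' + i * (kc - 1)) + (kc * n + i) = kc * (n + i) + i' := by
    intro n
    obtain ⟨k, rfl⟩ := Nat.exists_eq_add_of_le hkc
    rw [Nat.add_sub_cancel_left]; ring
  have h1 : Tendsto (fun n : ℕ => F P s (kc * (n + 1) + i') c - F P s (kc * n + i') c)
      atTop (𝓝 0) := by
    rw [← tendsto_add_atTop_iff_nat i]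
    refine hd.congr fun n => ?_
    rw [e, e, show n + 1 + i = n + i + 1 by ring]
  have hNl : Tendsto (fun n : ℕ => N * n) atTop atTop :=
    tendsto_id.const_mul_atTop' hN
  have hkl : Tendsto (fun n : ℕ => kc * n) atTop atTop :=
    tendsto_id.const_mul_atTop' hkc
  have h2 := h1.comp hNl
  have h3 := hlim.comp hkl
  have hcont : Continuous (fun z => F P s kc z) :=
    (continuous_F P kc).comp (by fun_prop : Continuous (fun z : ℂ => (s, z)))
  have h4 := ((hcont.tendsto σ).comp h3).sub h3
  have h5 := tendsto_nhds_unique (h2.congr fun n => ?_) h4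
  · exact (sub_eq_zero.1 h5.symm)
  · simp only [Function.comp]
    rw [← F_add]
    congr 2 <;> ring

theorem theoremA (hP : 2 ≤ P.natDegree) {m : ℕ} (hm : 1 ≤ m) {δ : ℝ} (hδ : 0 < δ) {l : ℂ}
    (hl : ‖l‖ = 1) {s x : ℂ → ℂ} (hs : DifferentiableOn ℂ s (ball 0 δ))
    (hx : DifferentiableOn ℂ x (ball 0 δ)) (hinj : InjOn s (ball 0 δ))
    (hper : ∀ τ ∈ ball 0 δ, F P (s τ) m (x τ) = x τ ∧ D P (s τ) m (x τ) = l * Complex.exp τ) :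
    ∃ τ ∈ ball (0 : ℂ) δ, 0 < τ.re ∧ ∃ c, P.derivative.eval c = 0 ∧
      ∃ N, F P (s τ) (N + 1) c = x τ := by
  by_contra hcon
  push Not at hcon
  set U : Set ℂ := ball 0 δ ∩ {τ | 0 < τ.re} with hUdef
  have hU : IsOpen U := isOpen_ball.inter (isOpen_lt continuous_const Complex.continuous_re)
  have hUc : IsPreconnected U :=
    ((convex_ball (0 : ℂ) δ).inter (convex_halfSpace_re_gt 0)).isPreconnected
  have hno : ∀ t ∈ U, ∀ c, P.derivative.eval c = 0 → ∀ N, F P (s t) (N + 1) c ≠ x t :=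
    fun t ht c hc N => hcon t ht.1 ht.2 c hc N
  have hsU := hs.mono (inter_subset_left : U ⊆ ball 0 δ)
  have hxU := hx.mono (inter_subset_left : U ⊆ ball 0 δ)
  have hrec : ∀ c : ℂ, ∃ kc : ℕ, 1 ≤ kc ∧ ((∃ t ∈ U, ∃ k i : ℕ, ∃ σ, 1 ≤ k ∧
      Tendsto (fun n => F P (s t) (k * n + i) c) atTop (𝓝 σ) ∧ F P (s t) k σ = σ ∧
      ‖D P (s t) k σ‖ < 1) → (∃ t ∈ U, ∃ i : ℕ, ∃ σ,
      Tendsto (fun n => F P (s t) (kc * n + i) c) atTop (𝓝 σ) ∧ F P (s t) kc σ = σ ∧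
      ‖D P (s t) kc σ‖ < 1)) := by
    intro c
    by_cases h : ∃ t ∈ U, ∃ k i : ℕ, ∃ σ, 1 ≤ k ∧
      Tendsto (fun n => F P (s t) (k * n + i) c) atTop (𝓝 σ) ∧ F P (s t) k σ = σ ∧
      ‖D P (s t) k σ‖ < 1
    · obtain ⟨t, ht, k, i, σ, hk, h1⟩ := h
      exact ⟨k, hk, fun _ => ⟨t, ht, i, σ, h1⟩⟩
    · exact ⟨1, le_rfl, fun h' => absurd h' h⟩
  choose kc hkc hatt using hrec
  have hPd : P.derivative ≠ 0 := by
    intro h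
    have := Polynomial.derivative_eq_zero.1 h
    omega
  set K := ∏ c ∈ P.derivative.roots.toFinset, kc c with hK
  have hK1 : 1 ≤ K := by
    have : 0 < K := Finset.prod_pos fun c _ => hkc c
    exact this
  obtain ⟨θ, hθ, ⟨k, hk, hk1⟩, hK2⟩ := choose_angle hl hδ hK1
  set t1 : ℂ := θ * Complex.I with ht1
  have ht1n : ‖t1‖ = |θ| := by rw [ht1]; simp
  have ht1b : t1 ∈ ball (0 : ℂ) δ := by rw [mem_ball_zero_iff, ht1n]; exact hθ
  have ht1re : t1.re = 0 := by rw [ht1]; simp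
  have hmK : D P (s t1) (m * K) (x t1) ≠ 1 := by
    rw [D_mul_fix (hper t1 ht1b).1, (hper t1 ht1b).2]; exact hK2
  obtain ⟨r, hr, huniq⟩ := local_unique hmK
  -- path
  have hmk : 1 ≤ m * k := Nat.mul_pos hm hk
  have hpath : Tendsto (fun h : ℝ => t1 + (h : ℂ)) (𝓝[>] 0) (𝓝 t1) := by
    have : Continuous (fun h : ℝ => t1 + (h : ℂ)) := by fun_prop
    have h := this.tendsto 0
    simp only [Complex.ofReal_zero, add_zero] at h
    exact h.mono_left nhdsWithin_le_nhds
  have hsc := (hs.continuousOn.continuousAt (isOpen_ball.mem_nhds ht1b)).tendsto.comp hpath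
  have hxc := (hx.continuousOn.continuousAt (isOpen_ball.mem_nhds ht1b)).tendsto.comp hpath
  have hin : ∀ᶠ h : ℝ in 𝓝[>] 0, t1 + (h : ℂ) ∈ ball (0 : ℂ) δ :=
    hpath.eventually (isOpen_ball.mem_nhds ht1b)
  have hpos : ∀ᶠ h : ℝ in 𝓝[>] 0, 0 < h := self_mem_nhdsWithin
  have hDval : ∀ h : ℝ, t1 + (h : ℂ) ∈ ball (0 : ℂ) δ →
      D P (s (t1 + h)) (m * k) (x (t1 + h)) = ((Real.exp (k * h) : ℝ) : ℂ) := by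
    intro h hh
    rw [D_mul_fix (hper _ hh).1, (hper _ hh).2, Complex.exp_add, ← mul_assoc, mul_pow, hk1, one_mul,
      ← Complex.exp_nat_mul]
    push_cast; rfl
  have hsimple : ∀ᶠ h : ℝ in 𝓝[>] 0, ∀ y, F P (s (t1 + h)) (m * k) y = y →
      D P (s (t1 + h)) (m * k) y ≠ 1 := by
    have hfin := finite_mult hP hmk (ω := 1) (by simp)
    set B := {s | ∃ x, F P s (m * k) x = x ∧ D P s (m * k) x = 1} with hB
    have hfin2 : ({h : ℝ | (0 < h ∧ t1 + (h : ℂ) ∈ ball (0 : ℂ) δ) ∧ s (t1 + h) ∈ B}).Finite := by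
      refine Set.Finite.of_finite_image (f := fun h : ℝ => s (t1 + h)) (hfin.subset ?_) ?_
      · rintro _ ⟨h, hh, rfl⟩; exact hh.2
      · intro a ha b hb hab
        have := hinj ha.1.2 hb.1.2 hab
        exact_mod_cast add_left_cancel this
    have hne : ∀ᶠ h : ℝ in 𝓝[>] 0,
        h ∉ {h : ℝ | (0 < h ∧ t1 + (h : ℂ) ∈ ball (0 : ℂ) δ) ∧ s (t1 + h) ∈ B} :=
      nhdsWithin_le_nhds (hfin2.isClosed.isOpen_compl.mem_nhds (fun h => lt_irrefl _ h.1.1))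
    filter_upwards [hne, hin, hpos] with h h1 h2 h3 y hy hy1
    exact h1 ⟨⟨h3, h2⟩, y, hy, hy1⟩
  have hDlim : Tendsto (fun h : ℝ => ((D P (s (t1 + h)) (m * k) (x (t1 + h)) - 1)⁻¹).re)
      (𝓝[>] 0) atTop := by
    have h1 : Tendsto (fun h : ℝ => Real.exp (k * h) - 1) (𝓝[>] 0) (𝓝[>] 0) := by
      refine tendsto_nhdsWithin_of_tendsto_nhds_of_eventually_within _ ?_ ?_
      · have : Continuous (fun h : ℝ => Real.exp (k * h) - 1) := by fun_prop
        have h := this.tendsto 0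
        simp only [mul_zero, Real.exp_zero, sub_self] at h
        exact h.mono_left nhdsWithin_le_nhds
      · filter_upwards [hpos] with h hh
        have : (0 : ℝ) < k := by exact_mod_cast hk
        exact sub_pos.2 (Real.one_lt_exp_iff.2 (by positivity))
    refine (tendsto_inv_nhdsGT_zero.comp h1).congr' ?_
    filter_upwards [hin] with h hh
    rw [hDval h hh]
    simp only [Function.comp]
    rw [← Complex.ofReal_one, ← Complex.ofReal_sub, ← Complex.ofReal_inv, Complex.ofReal_re]
  have hidx := index_lemma hP hmk (s := fun h : ℝ => s (t1 + h)) (x := fun h : ℝ => x (t1 + h))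
    hsc hxc (by
      filter_upwards [hin] with h hh
      exact F_mul_fix (hper _ hh).1 k) hsimple hDlim hr
  obtain ⟨h, ⟨⟨⟨⟨σ, hσr, hσx, hσF, hσD⟩, hh⟩, hh0⟩, hsr⟩, hxr⟩ :=
    ((((hidx.and hin).and hpos).and (hsc.eventually (ball_mem_nhds _ hr))).and
      (hxc.eventually (ball_mem_nhds _ hr))).exists
  set t3 : ℂ := t1 + h with ht3
  have ht3U : t3 ∈ U := ⟨hh, by
    show 0 < t3.re
    rw [ht3, Complex.add_re, ht1re, Complex.ofReal_re, zero_add]; exact hh0⟩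
  obtain ⟨c, hc, i', hlim⟩ := fatou hP hσF hσD
  obtain ⟨t, ht, i, σ', hlim', hF', hD'⟩ := hatt c ⟨t3, ht3U, m * k, i', σ, hmk, hlim, hσF, hσD⟩
  have hatt3 := attracted_everywhere hP hU hUc hsU hxU hno ht hc (hkc c) hlim' hF' hD'
    (i' + i * (kc c - 1)) t3 ht3U
  have hfix := attr_fix hmk (hkc c) hlim hatt3
  have hdvd : kc c ∣ K := Finset.dvd_prod_of_mem kc (by
    rw [Multiset.mem_toFinset, Polynomial.mem_roots hPd]; exact hc)
  obtain ⟨q, hq⟩ := hdvd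
  apply hσx
  refine huniq (s t3) hsr σ hσr (x t3) hxr ?_ (F_mul_fix (hper _ hh).1 K)
  rw [hq, show m * (kc c * q) = kc c * (m * q) by ring]
  exact F_mul_fix hfix _

end PB


namespace PB

variable {P : Polynomial ℂ}

theorem coeff_close (P : Polynomial ℂ) {ε : ℝ} (hε : 0 < ε) : ∃ η > 0, ∀ s x : ℂ, ‖s‖ < η →
    ‖x‖ < η → ∀ n, ‖(Polynomial.taylor x P + Polynomial.C (s - x)).coeff n - P.coeff n‖ < ε := by
  have h1 : ∀ n, ∀ᶠ x in 𝓝 (0 : ℂ), ‖(Polynomial.taylor x P).coeff n - P.coeff n‖ < ε / 2 := by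
    intro n
    have hc : Continuous (fun x => ‖(Polynomial.taylor x P).coeff n - P.coeff n‖) := by
      simp only [Polynomial.taylor_coeff]
      exact (((Polynomial.hasseDeriv n P).continuous).sub continuous_const).norm
    refine hc.continuousAt.eventually_lt_const ?_
    simp [half_pos hε]
  have h2 : ∀ᶠ x in 𝓝 (0 : ℂ), ∀ n ∈ Finset.range (P.natDegree + 1),
      ‖(Polynomial.taylor x P).coeff n - P.coeff n‖ < ε / 2 :=
    (Filter.eventually_all_finset _).2 fun n _ => h1 n
  obtain ⟨η, hη, hb⟩ := Metric.eventually_nhds_iff_ball.1 h2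
  refine ⟨min η (ε / 4), by positivity, fun s x hs hx n => ?_⟩
  have hx' := hb x (mem_ball_zero_iff.2 (hx.trans_le (min_le_left _ _)))
  have hA : ‖(Polynomial.taylor x P).coeff n - P.coeff n‖ < ε / 2 := by
    rcases Nat.lt_or_ge n (P.natDegree + 1) with h | h
    · exact hx' n (Finset.mem_range.2 h)
    · rw [Polynomial.coeff_eq_zero_of_natDegree_lt (by rw [Polynomial.natDegree_taylor]; omega),
        Polynomial.coeff_eq_zero_of_natDegree_lt (by omega)]
      simpa using hε
  have hB : ‖(Polynomial.C (s - x)).coeff n‖ < ε / 2 := by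
    rw [Polynomial.coeff_C]
    have h3 := hs.trans_le (min_le_right _ _)
    have h4 := hx.trans_le (min_le_right _ _)
    split_ifs
    · linarith [norm_sub_le s x]
    · simpa using hε
  rw [Polynomial.coeff_add]
  have := norm_add_le ((Polynomial.taylor x P).coeff n - P.coeff n) ((Polynomial.C (s - x)).coeff n)
  rw [show (Polynomial.taylor x P).coeff n + (Polynomial.C (s - x)).coeff n - P.coeff n =
    (Polynomial.taylor x P).coeff n - P.coeff n + (Polynomial.C (s - x)).coeff n by ring]
  linarith

theorem iter_Q (s x : ℂ) (n : ℕ) :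
    (fun z => (Polynomial.taylor x P + Polynomial.C (s - x)).eval z)^[n] =
      fun z => F P s n (z + x) - x := by
  induction n with
  | zero => funext z; simp [F_zero]
  | succ n ih =>
    funext z
    rw [Function.iterate_succ_apply', ih, F_succ]
    simp only [Polynomial.eval_add, Polynomial.taylor_eval, Polynomial.eval_C, sub_add_cancel]
    ring

theorem F_zero_param (P : Polynomial ℂ) (n : ℕ) : F P 0 n = (fun z => P.eval z)^[n] := by
  rw [F]; simp only [add_zero]

theorem exists_param (hP : 2 ≤ P.natDegree) {m : ℕ} (hm : 1 ≤ m) (h0 : F P 0 m 0 = 0)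
    (hD : ‖D P 0 m 0‖ = 1) {η : ℝ} (hη : 0 < η) : ∃ s x : ℂ, ‖s‖ < η ∧ ‖x‖ < η ∧
      F P s m x = x ∧ 1 < ‖D P s m x‖ ∧ ∃ c, P.derivative.eval c = 0 ∧
      ∃ N, F P s (N + 1) c = x := by
  obtain ⟨s0, x0, hs0, hx0, hF0, hD0, hD1⟩ : ∃ s x, ‖s‖ < η / 2 ∧ ‖x‖ < η / 2 ∧ F P s m x = x ∧
      ‖D P s m x‖ = 1 ∧ D P s m x ≠ 1 := by
    by_cases h : D P 0 m 0 = 1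
    · exact lemmaO hP hm h0 h (half_pos hη)
    · exact ⟨0, 0, by simpa using hη, by simpa using hη, h0, hD, h⟩
  obtain ⟨δ, hδ, l, hl, s, x, hs, hx, hinj, hall⟩ := lemmaN hP hm hF0 hD0 hD1 (half_pos hη)
  obtain ⟨τ, hτ, hre, c, hc, N, hN⟩ := theoremA hP hm hδ hl hs hx hinj
    (fun τ hτ => (hall τ hτ).2.2)
  obtain ⟨h1, h2, h3, h4⟩ := hall τ hτ
  refine ⟨s τ, x τ, ?_, ?_, h3, ?_, c, hc, N, hN⟩
  · have := norm_add_le (s τ - s0) s0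
    rw [sub_add_cancel] at this; linarith
  · have := norm_add_le (x τ - x0) x0
    rw [sub_add_cancel] at this; linarith
  · rw [h4, norm_mul, hl, one_mul, Complex.norm_exp]
    exact Real.one_lt_exp_iff.2 hre

end PB

theorem stmt_13 (d : ℕ) (hd : 2 ≤ d) (P : Polynomial ℂ) (hP : P.natDegree = d)
    (m : ℕ) (hm : 1 ≤ m) (hper : (fun z => P.eval z)^[m] 0 = 0)
    (hroot : ∃ k : ℕ, 1 ≤ k ∧ deriv ((fun z => P.eval z)^[m]) 0 ^ k = 1)
    (ε : ℝ) (hε : 0 < ε) :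
    ∃ Q : Polynomial ℂ, Q.natDegree = d ∧
      (∀ n : ℕ, ‖Q.coeff n - P.coeff n‖ < ε) ∧
      (fun z => Q.eval z)^[m] 0 = 0 ∧
      1 < ‖deriv ((fun z => Q.eval z)^[m]) 0‖ ∧
      (0 : ℂ) ∈ ⋃ n : ℕ, (fun z => Q.eval z)^[n + 1] '' {w : ℂ | Q.derivative.eval w = 0} := by
  rw [← PB.F_zero_param] at hper hroot
  obtain ⟨k, hk, hk1⟩ := hroot
  rw [(PB.hasDerivAt_F m 0).deriv] at hk1
  have hnorm := Complex.norm_eq_one_of_pow_eq_one hk1 (by omega)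
  obtain ⟨η, hη, hclose⟩ := PB.coeff_close P hε
  obtain ⟨s, x, hs, hx, hF, hD, c, hc, N, hN⟩ :=
    PB.exists_param (by omega : 2 ≤ P.natDegree) hm hper hnorm hη
  refine ⟨Polynomial.taylor x P + Polynomial.C (s - x), ?_, hclose s x hs hx, ?_, ?_, ?_⟩
  · rw [Polynomial.natDegree_add_C, Polynomial.natDegree_taylor, hP]
  · rw [PB.iter_Q]; simp only [zero_add, hF, sub_self]
  · rw [PB.iter_Q]
    have h1 : HasDerivAt (fun z => PB.F P s m (z + x) - x) (PB.D P s m (0 + x)) 0 :=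
      ((PB.hasDerivAt_F m (0 + x)).comp_add_const 0 x).sub_const x
    rw [h1.deriv, zero_add]; exact hD
  · refine Set.mem_iUnion.2 ⟨N, c - x, ?_, ?_⟩
    · show (Polynomial.taylor x P + Polynomial.C (s - x)).derivative.eval (c - x) = 0
      rw [Polynomial.derivative_add, Polynomial.derivative_C, add_zero, Polynomial.taylor_apply,
        Polynomial.derivative_comp]
      simp [hc]
    · rw [PB.iter_Q]; simp only [sub_add_cancel, hN, sub_self]
end

section
/- Let q(w) := w⁴ and let r₁ := 1, r₂ := e^{2πi/3}, r₃ := e^{4πi/3} be its three fixed points on the unit circle. Let R > 0. Then there exist λ ∈ (0,1), ε₀ > 0, l₀ ≥ 1, a₁ > 0, a₂ ∈ (0,1), and for each i ∈ {1,2,3} and each l ≥ l₀ an open neighborhood Uᵢ^l of rᵢ with diam(Uᵢ^l) ≤ a₁·a₂^l, such that for every l ≥ l₀ and every α ∈ ℂ∖{0}, the map g_α(z,w) := (λz + αw, w^{4^l}) satisfies: closure(D(0, |α|/ε₀)) × {w ∈ ℂ : R⁻¹ ≤ |w| ≤ R} ⊆ g_α( D(0, |α|/ε₀) × (U₁^l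 ∪ U₂^l ∪ U₃^l) ). -/
open Metric Set

lemma cover_real (x y s t : ℝ) (hs : s ^ 2 = 3) (ht : t ^ 2 = x ^ 2 + y ^ 2)
    (h1 : x < t / 2) (h2 : s * y < t + x) (h3 : -(s * y) < t + x) : False := by
  have hpos : 0 < t + x := by linarith
  have h4 : (s * y) ^ 2 < (t + x) ^ 2 := by
    apply sq_lt_sq'
    · linarith
    · exact h2
  have h5 : 3 * (t - x) * (t + x) < (t + x) * (t + x) := by
    have : (s * y) ^ 2 = 3 * y ^ 2 := by rw [mul_pow, hs]
    nlinarith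
  have h6 : 3 * (t - x) < t + x := lt_of_mul_lt_mul_right h5 hpos.le
  linarith

/-- The three fixed points. -/
noncomputable def rts : Fin 3 → ℂ := ![1, Complex.exp (2 * Real.pi * Complex.I / 3),
            Complex.exp (4 * Real.pi * Complex.I / 3)]

lemma rts1 : rts 1 = ⟨-1/2, √3/2⟩ := by
  have : rts 1 = Complex.exp (((Real.pi - Real.pi / 3 : ℝ) : ℂ) * Complex.I) := by
    simp only [rts, Matrix.cons_val_one, Matrix.cons_val_zero]
    congr 1; push_cast; ring
  rw [this]
  apply Complex.ext
  · rw [Complex.exp_ofReal_mul_I_re, Real.cos_pi_sub, Real.cos_pi_div_three]; norm_num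
  · rw [Complex.exp_ofReal_mul_I_im, Real.sin_pi_sub, Real.sin_pi_div_three]

lemma rts2 : rts 2 = ⟨-1/2, -√3/2⟩ := by
  have : rts 2 = Complex.exp (((Real.pi / 3 + Real.pi : ℝ) : ℂ) * Complex.I) := by
    simp only [rts, Matrix.cons_val]
    congr 1; push_cast; ring
  rw [this]
  apply Complex.ext
  · rw [Complex.exp_ofReal_mul_I_re, Real.cos_add_pi, Real.cos_pi_div_three]; norm_num
  · rw [Complex.exp_ofReal_mul_I_im, Real.sin_add_pi, Real.sin_pi_div_three]; ring

lemma rts_cube (i : Fin 3) : rts i ^ 3 = 1 := by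
  fin_cases i
  · simp [rts]
  · simp only [rts, Fin.mk_one, Matrix.cons_val_one, Matrix.cons_val_zero]
    rw [← Complex.exp_nat_mul, ← Complex.exp_two_pi_mul_I]
    congr 1; push_cast; ring
  · simp only [rts, Fin.reduceFinMk, Matrix.cons_val]
    rw [← Complex.exp_nat_mul, Complex.exp_eq_one_iff]
    exact ⟨2, by push_cast; ring⟩

lemma rts_norm (i : Fin 3) : ‖rts i‖ = 1 :=
  Complex.norm_eq_one_of_pow_eq_one (rts_cube i) (by norm_num)

lemma rts_pow (i : Fin 3) (l : ℕ) : rts i ^ 4 ^ l = rts i := by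
  induction l with
  | zero => simp
  | succ k ih => rw [pow_succ 4 k, pow_mul, ih, pow_succ, rts_cube, one_mul]

lemma cover (z : ℂ) (hz : ‖z‖ ≤ 2) : ∃ i, ‖z - rts i‖ ≤ 9 / 5 := by
  by_contra! h
  have key : ∀ i, (9/5 : ℝ) ^ 2 < (z.re - (rts i).re) ^ 2 + (z.im - (rts i).im) ^ 2 := by
    intro i
    have h1 := h i
    have h2 : ‖z - rts i‖ ^ 2 = (z.re - (rts i).re) ^ 2 + (z.im - (rts i).im) ^ 2 := by
      rw [Complex.sq_norm, Complex.normSq_apply]; simp; ring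
    rw [← h2]
    gcongr
  have ht : ‖z‖ ^ 2 = z.re ^ 2 + z.im ^ 2 := by
    rw [Complex.sq_norm, Complex.normSq_apply]; ring
  have hs : (√3 : ℝ) ^ 2 = 3 := Real.sq_sqrt (by norm_num)
  have h0 := norm_nonneg z
  have k0 := key 0
  have k1 := key 1
  have k2 := key 2
  rw [rts1] at k1
  rw [rts2] at k2
  simp only [rts, Matrix.cons_val_zero, Complex.one_re, Complex.one_im] at k0
  simp only at k1 k2
  apply cover_real z.re z.im √3 ‖z‖ hs ht <;> nlinarith

lemma root (K : ℝ) (i : Fin 3) (N : ℕ) (hN : K ≤ N) (hN0 : 0 < N) (hr : rts i ^ N = rts i) (v : ℂ)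
    (hv : v ≠ 0) (hK : |Real.log ‖v‖| + Real.pi ≤ K) :
    ∃ w : ℂ, w ^ N = v ∧ ‖w - rts i‖ ≤ 2 * K / N := by
  have hn := rts_norm i
  have hr0 : rts i ≠ 0 := by
    intro h; rw [h] at hn; simp at hn
  have hN' : (0:ℝ) < N := by exact_mod_cast hN0
  set s := Complex.log (v / rts i) with hs
  have hsK : ‖s‖ ≤ K := by
    refine (Complex.norm_le_abs_re_add_abs_im s).trans ?_
    rw [hs, Complex.log_re, Complex.log_im, norm_div, hn, div_one]
    linarith [Complex.abs_arg_le_pi (v / rts i)]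
  have hsN : ‖s / N‖ ≤ K / N := by
    rw [norm_div, Complex.norm_natCast]; gcongr
  refine ⟨rts i * Complex.exp (s / N), ?_, ?_⟩
  · rw [mul_pow, hr, ← Complex.exp_nat_mul, mul_div_cancel₀ _ (by exact_mod_cast hN0.ne'), hs,
      Complex.exp_log (div_ne_zero hv hr0), mul_div_cancel₀ _ hr0]
  · have : rts i * Complex.exp (s / N) - rts i = rts i * (Complex.exp (s / N) - 1) := by ring
    rw [this, norm_mul, hn, one_mul]
    have h1 : ‖s / N‖ ≤ 1 := hsN.trans ((div_le_one hN').2 hN)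
    refine (Complex.norm_exp_sub_one_le h1).trans ?_
    rw [mul_div_assoc]
    linarith

/-- Lemma 6.1: for `q(w) = w⁴` with fixed points `r₁ = 1`, `r₂ = e^{2πi/3}`, `r₃ = e^{4πi/3}`
and any `R > 0`, there are `λ ∈ (0,1)`, `ε₀ > 0`, `l₀ ≥ 1`, shrinking neighborhoods `Uᵢ^l` of
`rᵢ`, such that for every `l ≥ l₀` and `α ≠ 0` the map `g_α(z,w) = (λ z + α w, w^{4^l})`
satisfies the covering property of the statement. -/
theorem stmt_14 (R : ℝ) (hR : 0 < R) :
    ∃ (lam ε₀ : ℝ) (l₀ : ℕ) (a₁ a₂ : ℝ) (U : Fin 3 → ℕ → Set ℂ),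
      0 < lam ∧ lam < 1 ∧ 0 < ε₀ ∧ 1 ≤ l₀ ∧ 0 < a₁ ∧ 0 < a₂ ∧ a₂ < 1 ∧
      (∀ i : Fin 3, ∀ l, l₀ ≤ l →
        IsOpen (U i l) ∧
        (![1, Complex.exp (2 * Real.pi * Complex.I / 3),
            Complex.exp (4 * Real.pi * Complex.I / 3)] i ∈ U i l) ∧
        EMetric.diam (U i l) ≤ ENNReal.ofReal (a₁ * a₂ ^ l)) ∧
      ∀ l, l₀ ≤ l → ∀ α : ℂ, α ≠ 0 →
        closure (ball (0:ℂ) (‖α‖ / ε₀)) ×ˢ {w : ℂ | R⁻¹ ≤ ‖w‖ ∧ ‖w‖ ≤ R} ⊆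
          (fun x : ℂ × ℂ => ((lam : ℂ) * x.1 + α * x.2, x.2 ^ 4 ^ l)) ''
            (ball (0:ℂ) (‖α‖ / ε₀) ×ˢ (U 0 l ∪ U 1 l ∪ U 2 l)) := by
  obtain ⟨K, hKdef⟩ : ∃ K, K = |Real.log R| + Real.pi := ⟨_, rfl⟩
  have hK : 0 < K := by rw [hKdef]; positivity
  obtain ⟨n, hn⟩ := pow_unbounded_of_one_lt (10 * (2 * K + 1)) (by norm_num : (1:ℝ) < 4)
  refine ⟨19/20, 1/2, n + 1, 2 * (2 * K + 1), 1/4,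
    fun i l => ball (rts i) ((2 * K + 1) / 4 ^ l), by norm_num, by norm_num, by norm_num,
    by omega, by positivity, by norm_num, by norm_num, ?_, ?_⟩
  · intro i l _
    refine ⟨isOpen_ball, mem_ball_self (by positivity), ?_⟩
    have h4 : 2 * (2 * K + 1) * (1 / 4) ^ l = 2 * ((2 * K + 1) / 4 ^ l) := by
      rw [div_pow, one_pow]; ring
    change Metric.ediam (ball (rts i) ((2 * K + 1) / 4 ^ l)) ≤ _
    rw [h4, ENNReal.ofReal_mul (by norm_num), ← Metric.eball_ofReal]
    simpa using Metric.ediam_eball_le (x := rts i) (r := ENNReal.ofReal ((2 * K + 1) / 4 ^ l))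
  · rintro l hl α hα ⟨z, v⟩ ⟨hz, hv1, hv2⟩
    have hα' : 0 < ‖α‖ := norm_pos_iff.2 hα
    have hz' : ‖z‖ ≤ ‖α‖ * 2 := by
      have := closure_ball_subset_closedBall hz
      rw [mem_closedBall_zero_iff] at this
      simp only at this
      linarith
    simp only at hv1 hv2
    have hv0 : 0 < ‖v‖ := lt_of_lt_of_le (inv_pos.2 hR) hv1
    have hlog : |Real.log ‖v‖| + Real.pi ≤ K := by
      have h1 := Real.log_le_log hv0 hv2
      have h2 := Real.log_le_log (inv_pos.2 hR) hv1
      rw [Real.log_inv] at h2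
      have h3 : |Real.log ‖v‖| ≤ Real.log R := abs_le.2 ⟨h2, h1⟩
      rw [hKdef]
      linarith [le_abs_self (Real.log R)]
    have hNl : 10 * (2 * K + 1) < (4:ℝ) ^ l :=
      hn.trans_le (pow_le_pow_right₀ (by norm_num) (by omega))
    obtain ⟨i, hi⟩ := cover (z / α) (by
      rw [norm_div, div_le_iff₀ hα']; linarith)
    obtain ⟨w, hw, hwi⟩ := root K i (4 ^ l) (by push_cast; linarith) (by positivity)
      (rts_pow i l) v (norm_pos_iff.1 hv0) hlog
    push_cast at hwi
    have hwi' : ‖w - rts i‖ < (2 * K + 1) / 4 ^ l :=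
      hwi.trans_lt (by gcongr; linarith)
    have hsmall : (2 * K + 1) / 4 ^ l < 1 / 10 := by
      rw [div_lt_iff₀ (by positivity)]; linarith
    refine ⟨(((20/19 : ℝ) : ℂ) * (z - α * w), w), ⟨?_, ?_⟩, ?_⟩
    · rw [mem_ball_zero_iff]
      have e : z - α * w = α * ((z / α - rts i) - (w - rts i)) := by
        field_simp; ring
      have h5 : ‖z / α - rts i - (w - rts i)‖ < 19 / 10 :=
        (norm_sub_le _ _).trans_lt (by linarith)
      simp only
      rw [e, norm_mul, norm_mul, Complex.norm_real]
      have h6 := mul_lt_mul_of_pos_left h5 hα'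
      have h7 : ‖(20/19 : ℝ)‖ = 20/19 := by norm_num
      rw [h7]
      linarith
    · have hb : w ∈ ball (rts i) ((2 * K + 1) / 4 ^ l) := by
        rw [mem_ball, dist_eq_norm]; exact hwi'
      fin_cases i
      · exact Or.inl (Or.inl hb)
      · exact Or.inl (Or.inr hb)
      · exact Or.inr hb
    · simp only [hw, Prod.mk.injEq, and_true]
      push_cast
      ring
end

section
/- Let ψ(w) := (iw+1)/(w+i). There exists R₀ > 1 such that for every R ≥ R₀ there exists an integer l̃ ≥ 1 with the following property: for every u ∈ ℂ there exists w ∈ ℂ with R⁻¹ < |w| < R, w ≠ −i, and ((iw+1)/(w+i))^{4^{l̃}} = u. -/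
open Complex in
lemma aux_root (u : ℂ) : ∃ v : ℂ, v ^ 4 = u ∧ v.im ^ 2 ≤ v.re ^ 2 := by
  obtain ⟨v, hv⟩ := IsAlgClosed.exists_pow_nat_eq u (n := 4) (by norm_num)
  rcases le_total (v.im ^ 2) (v.re ^ 2) with h | h
  · exact ⟨v, hv, h⟩
  · refine ⟨I * v, ?_, ?_⟩
    · rw [mul_pow, I_pow_four, one_mul, hv]
    · simpa using h

open Complex in
lemma aux_bound (v : ℂ) (h : v.im ^ 2 ≤ v.re ^ 2) :
    ‖v + I‖ < 3 * ‖v - I‖ ∧ ‖v - I‖ < 3 * ‖v + I‖ := by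
  have h1 : ‖v + I‖ ^ 2 = v.re ^ 2 + (v.im + 1) ^ 2 := by
    rw [← normSq_eq_norm_sq, normSq_apply]; simp; ring
  have h2 : ‖v - I‖ ^ 2 = v.re ^ 2 + (v.im - 1) ^ 2 := by
    rw [← normSq_eq_norm_sq, normSq_apply]; simp; ring
  constructor
  · apply lt_of_pow_lt_pow_left₀ 2 (by positivity)
    rw [mul_pow, h1, h2]
    nlinarith [sq_nonneg (8 * v.im - 5)]
  · apply lt_of_pow_lt_pow_left₀ 2 (by positivity)
    rw [mul_pow, h1, h2]
    nlinarith [sq_nonneg (8 * v.im + 5)]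

/-- The surjectivity claim `q^{l̃} ∘ ψ (R𝔻 ∖ R⁻¹𝔻) = ℙ¹` (restricted to finite values)
from the proof of Lemma 6.2: for `ψ(w) = (iw+1)/(w+i)`, there is `R₀ > 1` such that for every
`R ≥ R₀` there is `l̃ ≥ 1` such that every `u ∈ ℂ` is of the form `ψ(w)^{4^{l̃}}` for some `w`
in the annulus `R⁻¹ < |w| < R` (with `w ≠ -i`). -/
theorem stmt_16 :
    ∃ R₀ : ℝ, 1 < R₀ ∧ ∀ R : ℝ, R₀ ≤ R → ∃ l : ℕ, 1 ≤ l ∧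
      ∀ u : ℂ, ∃ w : ℂ, R⁻¹ < ‖w‖ ∧ ‖w‖ < R ∧ w ≠ -Complex.I ∧
        ((Complex.I * w + 1) / (w + Complex.I)) ^ 4 ^ l = u := by
  refine ⟨3, by norm_num, fun R hR => ⟨1, le_refl _, fun u => ?_⟩⟩
  obtain ⟨v, hv, hvi⟩ := aux_root u
  obtain ⟨hb1, hb2⟩ := aux_bound v hvi
  have hp : 0 < ‖v - Complex.I‖ := by linarith [norm_nonneg (v + Complex.I)]
  have hp' : 0 < ‖v + Complex.I‖ := by linarith
  have hne : v - Complex.I ≠ 0 := norm_pos_iff.mp hp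
  have hI := Complex.I_mul_I
  have hw : ‖(1 - Complex.I * v) / (v - Complex.I)‖ = ‖v + Complex.I‖ / ‖v - Complex.I‖ := by
    have : 1 - Complex.I * v = -Complex.I * (v + Complex.I) := by linear_combination hI
    rw [norm_div, this, norm_mul, norm_neg, Complex.norm_I, one_mul]
  have hs : (1 - Complex.I * v) / (v - Complex.I) + Complex.I = 2 / (v - Complex.I) := by
    field_simp
    linear_combination -hI
  have ht : Complex.I * ((1 - Complex.I * v) / (v - Complex.I)) + 1 = 2 * v / (v - Complex.I) := by
    field_simp
    linear_combination -v * hI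
  refine ⟨(1 - Complex.I * v) / (v - Complex.I), ?_, ?_, ?_, ?_⟩
  · rw [hw, lt_div_iff₀ hp, inv_mul_lt_iff₀ (by linarith)]
    nlinarith
  · rw [hw, div_lt_iff₀ hp]
    nlinarith
  · intro h
    rw [h, neg_add_cancel] at hs
    exact div_ne_zero two_ne_zero hne hs.symm
  · rw [hs, ht, pow_one, ← hv]
    congr 1
    field_simp
end
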